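/- arXiv:2402.13340 — 10 statements merged into one kernel-verified Lean document; each statement's English description precedes it below -/
import Mathlib

section
/- Let S be a finite set of points in ℝ² colored by c : ℝ² → Fin k (k ≥ 2). Suppose there exist m ≥ 1 and points p₀, p₁, …, p_{2m−1} ∈ S in convex position, listed in the cyclic order in which they occur as vertices of the boundary of their convex hull, such that c(p_i) ≠ c(p_{(i+1) mod 2m}) for every i. Then every island partition of S has cardinality at least m + 1; in particular Opt_P ≥ m + 1. -/
/-- `I` is an island of `S`: a subset whose convex hull contains no other points of `S`. -/
def IsIsland (S I : Set (ℝ × ℝ)) : Prop :=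
  I ⊆ S ∧ convexHull ℝ I ∩ S = I

/-- A set of points is monochromatic under coloring `c`. -/
def Monochromatic {k : ℕ} (c : ℝ × ℝ → Fin k) (P : Set (ℝ × ℝ)) : Prop :=
  ∀ p ∈ P, ∀ q ∈ P, c p = c q

/-- An island partition of `S`: a finite family of monochromatic islands with
pairwise-disjoint convex hulls whose union is `S`. -/
def IsIslandPartition {k : ℕ} (S : Set (ℝ × ℝ)) (c : ℝ × ℝ → Fin k)
    (P : Finset (Set (ℝ × ℝ))) : Prop :=
  (∀ I ∈ P, IsIsland S I ∧ Monochromatic c I) ∧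
  (∀ I ∈ P, ∀ J ∈ P, I ≠ J → convexHull ℝ I ∩ convexHull ℝ J = ∅) ∧
  (⋃ I ∈ P, I) = S

/-- Signed area determinant of three points in the plane (orientation test). -/
def detT (a b c : ℝ × ℝ) : ℝ :=
  (b.1 - a.1) * (c.2 - a.2) - (b.2 - a.2) * (c.1 - a.1)

/-- A sequence of length `n + 1` over `P` without equal neighbours and without an alternation
`a b a b` satisfies `n + 2 ≤ 2 * #P` (Davenport–Schinzel bound of order two). -/
theorem Finset.add_two_le_two_mul_card_of_noncrossing {α : Type*} (P : Finset α) (n : ℕ)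
    (f : ℕ → α) (hf : ∀ i ≤ n, f i ∈ P) (hne : ∀ i < n, f i ≠ f (i + 1))
    (hcross : ∀ i j k l, i < j → j < k → k < l → l ≤ n → f i = f k → f j = f l → f i = f j) :
    n + 2 ≤ 2 * P.card := by
  classical
  set A := (Finset.range n).filter fun i => ∀ j, i < j → j ≤ n → f j ≠ f i with hA
  set B := (Finset.range n).filter fun i => ∀ j ≤ i, f j ≠ f (i + 1) with hB
  have hcover : Finset.range n ⊆ A ∪ B := by
    intro i hi
    have hin := Finset.mem_range.1 hi
    by_contra h
    simp only [hA, hB, Finset.mem_union, Finset.mem_filter, hi, true_and, not_or] at h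
    push Not at h
    obtain ⟨⟨l, hil, hln, hl⟩, j, hji, hj⟩ := h
    have hji' : j ≠ i := fun e => hne i hin (e ▸ hj)
    have hil' : l ≠ i + 1 := fun e => hne i hin (e ▸ hl).symm
    exact hne i hin
      ((hcross j i (i + 1) l (by omega) (by omega) (by omega) hln hj hl.symm).symm.trans hj)
  have hAcard : A.card ≤ (P.erase (f n)).card := by
    refine Finset.card_le_card_of_injOn f ?_ ?_
    · intro i hi
      obtain ⟨hin, hi⟩ := Finset.mem_filter.1 (Finset.mem_coe.1 hi)
      have hin := Finset.mem_range.1 hin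
      exact Finset.mem_coe.2 (Finset.mem_erase.2 ⟨(hi n hin le_rfl).symm, hf i hin.le⟩)
    · intro i hi j hj hij
      obtain ⟨hin, hi⟩ := Finset.mem_filter.1 (Finset.mem_coe.1 hi)
      obtain ⟨hjn, hj⟩ := Finset.mem_filter.1 (Finset.mem_coe.1 hj)
      have hin := Finset.mem_range.1 hin
      have hjn := Finset.mem_range.1 hjn
      rcases lt_trichotomy i j with h | h | h
      · exact absurd hij.symm (hi j h hjn.le)
      · exact h
      · exact absurd hij (hj i h hin.le)
  have hBcard : B.card ≤ (P.erase (f 0)).card := by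
    refine Finset.card_le_card_of_injOn (fun i => f (i + 1)) ?_ ?_
    · intro i hi
      obtain ⟨hin, hi⟩ := Finset.mem_filter.1 (Finset.mem_coe.1 hi)
      have hin := Finset.mem_range.1 hin
      exact Finset.mem_coe.2 (Finset.mem_erase.2 ⟨(hi 0 (Nat.zero_le i)).symm, hf (i + 1) hin⟩)
    · intro i hi j hj hij
      obtain ⟨-, hi⟩ := Finset.mem_filter.1 (Finset.mem_coe.1 hi)
      obtain ⟨-, hj⟩ := Finset.mem_filter.1 (Finset.mem_coe.1 hj)
      rcases lt_trichotomy i j with h | h | h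
      · exact absurd hij (hj (i + 1) h)
      · exact h
      · exact absurd hij.symm (hi (j + 1) h)
  rw [Finset.card_erase_of_mem (hf n le_rfl)] at hAcard
  rw [Finset.card_erase_of_mem (hf 0 (Nat.zero_le n))] at hBcard
  have hpos : 0 < P.card := Finset.card_pos.2 ⟨_, hf 0 (Nat.zero_le n)⟩
  have hn := (Finset.card_le_card hcover).trans (Finset.card_union_le A B)
  rw [Finset.card_range] at hn
  omega

/-- If every other point lies on the same side of each edge `q i q (i + 1)`, then all triples
`i < j < k` have that same orientation. The sign `s` selects the side. -/
theorem detT_pos_of_edges {n : ℕ} {q : ℕ → ℝ × ℝ} {s : ℝ}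
    (h : ∀ i j, i + 1 < n → j < n → j ≠ i → j ≠ i + 1 → 0 < s * detT (q i) (q (i + 1)) (q j))
    {i j k : ℕ} (hij : i < j) (hjk : j < k) (hk : k < n) :
    0 < s * detT (q i) (q j) (q k) := by
  have hcons : ∀ k, i < k → k + 1 < n → 0 < s * detT (q i) (q k) (q (k + 1)) := by
    intro k hik hk
    have := h k i hk (by omega) (by omega) (by omega)
    convert this using 1
    simp only [detT]
    ring
  induction k, hjk using Nat.le_induction with
  | base => exact hcons j hij hk
  | succ k hjk ih =>
    have hprev : 0 < s * detT (q i) (q j) (q k) := ih (by omega)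
    have hkk := hcons k (by omega) hk
    have hk1 := h i k (by omega) (by omega) (by omega) (by omega)
    have hk2 := h i (k + 1) (by omega) hk (by omega) (by omega)
    have hj : 0 ≤ s * detT (q i) (q (i + 1)) (q j) := by
      rcases eq_or_ne j (i + 1) with rfl | hne
      · simp [detT, mul_comm]
      · exact (h i j (by omega) (by omega) (by omega) hne).le
    have plucker : (s * detT (q i) (q (i + 1)) (q k)) * (s * detT (q i) (q j) (q (k + 1))) =
        (s * detT (q i) (q (i + 1)) (q j)) * (s * detT (q i) (q k) (q (k + 1))) +
        (s * detT (q i) (q (i + 1)) (q (k + 1))) * (s * detT (q i) (q j) (q k)) := by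
      simp only [detT]
      ring
    refine pos_of_mul_pos_right (a := s * detT (q i) (q (i + 1)) (q k)) ?_ hk1.le
    rw [plucker]
    exact add_pos_of_nonneg_of_pos (mul_nonneg hj hkk.le) (mul_pos hk2 hprev)

/-- The diagonals of a convex quadrilateral meet. -/
theorem segment_inter_segment_nonempty_of_detT {a b c d : ℝ × ℝ} {s : ℝ}
    (habc : 0 < s * detT a b c) (habd : 0 < s * detT a b d)
    (hacd : 0 < s * detT a c d) (hbcd : 0 < s * detT b c d) :
    (segment ℝ a c ∩ segment ℝ b d).Nonempty := by
  have hsum : s * detT b c d + s * detT a b d = s * detT a c d + s * detT a b c := by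
    simp only [detT]
    ring
  have hpos := add_pos hbcd habd
  have hpos' := add_pos hacd habc
  refine ⟨(s * detT b c d / (s * detT b c d + s * detT a b d)) • a +
    (s * detT a b d / (s * detT b c d + s * detT a b d)) • c,
    ⟨_, _, by positivity, by positivity, by rw [← add_div, div_self (ne_of_gt ‹_›)], rfl⟩,
    s * detT a c d / (s * detT a c d + s * detT a b c),
    s * detT a b c / (s * detT a c d + s * detT a b c),
    by positivity, by positivity, by rw [← add_div, div_self (ne_of_gt ‹_›)], ?_⟩
  rw [hsum]
  ext <;> simp only [Prod.fst_add, Prod.snd_add, Prod.smul_fst, Prod.smul_snd, smul_eq_mul,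
    div_mul_eq_mul_div, ← add_div] <;> congr 1 <;> simp only [detT] <;> ring

/-- If an instance contains `2m` points in convex position, listed in cyclic order
around their convex hull, with alternating colors, then every island partition has
cardinality at least `m + 1`. -/
theorem stmt_0 {k : ℕ} (hk : 2 ≤ k) (S : Finset (ℝ × ℝ)) (c : ℝ × ℝ → Fin k)
    (m : ℕ) (hm : 1 ≤ m) (p : ZMod (2 * m) → ℝ × ℝ)
    (hpS : ∀ i, p i ∈ S)
    (hinj : Function.Injective p)
    (hconvpos : ∀ i, p i ∉ convexHull ℝ (p '' {j | j ≠ i}))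
    (hcyc : (∀ i j, j ≠ i → j ≠ i + 1 → 0 < detT (p i) (p (i + 1)) (p j)) ∨
            (∀ i j, j ≠ i → j ≠ i + 1 → detT (p i) (p (i + 1)) (p j) < 0))
    (halt : ∀ i, c (p i) ≠ c (p (i + 1)))
    (P : Finset (Set (ℝ × ℝ))) (hP : IsIslandPartition (↑S) c P) :
    m + 1 ≤ P.card := by
  obtain ⟨hisl, hdisj, hunion⟩ := hP
  set q : ℕ → ℝ × ℝ := fun i => p (i : ZMod (2 * m)) with hq
  obtain ⟨s, hs⟩ : ∃ s : ℝ, ∀ i j, j ≠ i → j ≠ i + 1 →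
      0 < s * detT (p i) (p (i + 1)) (p j) := by
    rcases hcyc with h | h
    · exact ⟨1, fun i j h₁ h₂ => by simpa using h i j h₁ h₂⟩
    · exact ⟨-1, fun i j h₁ h₂ => by simpa using h i j h₁ h₂⟩
  have hcast : ∀ i j : ℕ, i < 2 * m → j < 2 * m → i ≠ j →
      (i : ZMod (2 * m)) ≠ (j : ZMod (2 * m)) := by
    intro i j hi hj hij h
    rw [ZMod.natCast_eq_natCast_iff] at h
    exact hij (Nat.ModEq.eq_of_lt_of_lt h hi hj)
  have hedge : ∀ i j, i + 1 < 2 * m → j < 2 * m → j ≠ i → j ≠ i + 1 →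
      0 < s * detT (q i) (q (i + 1)) (q j) := by
    intro i j hi hj h₁ h₂
    have := hs i j (hcast j i hj (by omega) h₁)
      (by exact_mod_cast hcast j (i + 1) hj hi h₂)
    simpa only [hq, Nat.cast_add, Nat.cast_one] using this
  have hmem : ∀ i, ∃ I ∈ P, q i ∈ I := by
    intro i
    have h : q i ∈ (⋃ I ∈ P, I) := hunion ▸ hpS i
    simpa only [Set.mem_iUnion, exists_prop] using h
  choose f hfP hqf using hmem
  have key := P.add_two_le_two_mul_card_of_noncrossing (2 * m - 1) f (fun i _ => hfP i) ?_ ?_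
  · omega
  · intro i _ h
    have hc := (hisl _ (hfP i)).2 _ (hqf i) _ (h ▸ hqf (i + 1))
    exact halt i (by simpa only [hq, Nat.cast_add, Nat.cast_one] using hc)
  · intro i j k l hij hjk hkl hl hik hjl
    by_contra hne
    obtain ⟨x, hx₁, hx₂⟩ := segment_inter_segment_nonempty_of_detT
      (detT_pos_of_edges hedge hij hjk (by omega))
      (detT_pos_of_edges hedge hij (hjk.trans hkl) (by omega))
      (detT_pos_of_edges hedge (hij.trans hjk) hkl (by omega))
      (detT_pos_of_edges hedge hjk hkl (by omega))
    have hx : x ∈ convexHull ℝ (f i) ∩ convexHull ℝ (f j) :=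
      ⟨segment_subset_convexHull (hqf i) (hik ▸ hqf k) hx₁,
        segment_subset_convexHull (hqf j) (hjl ▸ hqf l) hx₂⟩
    rw [hdisj _ (hfP i) _ (hfP j) hne] at hx
    exact hx
end

section
/- Let S be a finite set of points in ℝ² colored by c : ℝ² → Fin k (k ≥ 2). If S admits an island partition 𝒫 of cardinality m ≥ 3, then there exists a finite set L of lines in ℝ² with |L| ≤ 3m − 6 such that for every pair of points p, q ∈ S with c(p) ≠ c(q), the closed segment [p, q] intersects ⋃L. -/
/-- A line in the plane: `{x | ⟪a, x⟫ = b}` for some `a ≠ 0`. -/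
def IsLine (ℓ : Set (ℝ × ℝ)) : Prop :=
  ∃ (a : ℝ × ℝ) (b : ℝ), a ≠ 0 ∧ ℓ = {x : ℝ × ℝ | a.1 * x.1 + a.2 * x.2 = b}

/-- A state of a sweep in which the elements of `B` have been inserted so far, `l` lists the
elements that are still present, and `E` holds all pairs that have been consecutive. -/
structure SweepState {ι : Type*} (B : Finset ι) (l : List ι) (E : Finset (ι × ι)) : Prop where
  nodup : l.Nodup
  subset : ∀ a ∈ l, a ∈ B
  chain : l.IsChain (fun a b => (a, b) ∈ E)
  bound : (B.card ≤ 1 ∧ E.card = 0) ∨ (B.card = 2 ∧ E.card ≤ 1) ∨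
    (3 ≤ B.card ∧ E.card + max l.length 2 + 4 ≤ 3 * B.card) ∨
    (3 ≤ B.card ∧ E.card + l.length + 3 ≤ 3 * B.card ∧
      ∃ a m b, m ≠ [] ∧ l = a :: (m ++ [b]) ∧ (a, b) ∈ E)

namespace SweepState

variable {ι : Type*} {B : Finset ι} {l : List ι} {E : Finset (ι × ι)}

theorem empty : SweepState (∅ : Finset ι) [] ∅ :=
  ⟨List.nodup_nil, by simp, List.IsChain.nil, Or.inl (by simp)⟩

theorem card_le (h : SweepState B l E) {m : ℕ} (hB : B.card ≤ m) (hm : 3 ≤ m) :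
    E.card ≤ 3 * m - 6 := by
  rcases h.bound with h | h | h | ⟨h1, h2, a, w, b, hw, rfl, -⟩
  · omega
  · omega
  · omega
  · have : 0 < w.length := List.length_pos_of_ne_nil hw
    simp at h2
    omega

theorem length_le (h : SweepState B l E) : l.length ≤ B.card := by
  classical
  rw [← List.toFinset_card_of_nodup h.nodup]
  exact Finset.card_le_card fun a ha => h.subset a (List.mem_toFinset.1 ha)

variable [DecidableEq ι]

theorem insert_elem {u v : List ι} {x : ι} (h : SweepState B (u ++ v) E) (hx : x ∉ B) :
    ∃ E', E ⊆ E' ∧ SweepState (insert x B) (u ++ x :: v) E' := by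
  have hnd : (u ++ x :: v).Nodup := by
    rw [List.nodup_middle, List.nodup_cons]
    exact ⟨fun hxl => hx (h.subset x hxl), h.nodup⟩
  have hsub : ∀ a ∈ u ++ x :: v, a ∈ insert x B := by
    intro a ha
    have := h.subset a
    simp only [List.mem_append, List.mem_cons, Finset.mem_insert] at ha this ⊢
    tauto
  have hcard : (insert x B).card = B.card + 1 := Finset.card_insert_of_notMem hx
  have hlen := h.length_le
  have hb := h.bound
  have hc := h.chain
  rcases List.eq_nil_or_concat u with rfl | ⟨u, d, rfl⟩
  · rcases v with _ | ⟨e, v⟩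
    · refine ⟨E, subset_rfl, hnd, hsub, by simp, ?_⟩
      rw [hcard]
      rcases hb with hb | hb | hb | ⟨-, -, a, m, b, -, hl, -⟩
      · omega
      · simp; omega
      · simp at hb ⊢; omega
      · simp at hl
    · have hE : (insert (x, e) E).card ≤ E.card + 1 := Finset.card_insert_le _ _
      refine ⟨insert (x, e) E, Finset.subset_insert _ _, hnd, hsub, ?_, ?_⟩
      · simp only [List.nil_append] at hc ⊢
        exact List.isChain_cons_cons.2 ⟨by simp, hc.imp fun a b => Finset.mem_insert_of_mem⟩
      · rw [hcard]
        simp only [List.nil_append, List.length_cons] at *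
        rcases hb with hb | hb | hb | ⟨h1, h2, a, m, b, hm, hl, -⟩
        · omega
        · omega
        · omega
        · have := congrArg List.length hl
          simp at this
          omega
  · rw [List.concat_eq_append] at *
    rcases v with _ | ⟨e, v⟩
    · have hE : (insert (d, x) E).card ≤ E.card + 1 := Finset.card_insert_le _ _
      refine ⟨insert (d, x) E, Finset.subset_insert _ _, hnd, hsub, ?_, ?_⟩
      · rw [List.append_assoc, List.singleton_append, List.isChain_append_cons_cons]
        rw [List.append_nil] at hc
        exact ⟨hc.imp fun a b => Finset.mem_insert_of_mem, by simp, by simp⟩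
      · rw [hcard]
        simp only [List.append_nil, List.length_append, List.length_cons, List.length_nil] at *
        rcases hb with hb | hb | hb | ⟨h1, h2, a, m, b, hm, hl, -⟩
        · omega
        · omega
        · omega
        · have := congrArg List.length hl
          simp at this
          omega
    · have hE : (insert (d, x) (insert (x, e) E)).card ≤ E.card + 2 :=
        (Finset.card_insert_le _ _).trans (by have := Finset.card_insert_le (x, e) E; omega)
      refine ⟨insert (d, x) (insert (x, e) E), by grind, hnd, hsub, ?_, ?_⟩
      · rw [List.append_assoc, List.singleton_append, List.isChain_append_cons_cons] at hc ⊢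
        refine ⟨hc.1.imp fun a b hab => by simp [hab], by simp, ?_⟩
        exact List.isChain_cons_cons.2 ⟨by simp, hc.2.2.imp fun a b hab => by simp [hab]⟩
      · rw [hcard]
        simp only [List.length_append, List.length_cons, List.length_nil] at *
        rcases hb with hb | hb | hb | ⟨h1, h2, a, m, b, hm, hl, hab⟩
        · omega
        · have hu : u = [] := List.eq_nil_of_length_eq_zero (by omega)
          have hv : v = [] := List.eq_nil_of_length_eq_zero (by omega)
          subst hu hv
          refine Or.inr (Or.inr (Or.inr ⟨by omega, by simp; omega, d, [x], e, by simp, by simp, ?_⟩))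
          simp only [List.nil_append, List.singleton_append, List.isChain_cons_cons] at hc
          simp [hc.1]
        · omega
        · refine Or.inr (Or.inr (Or.inr ⟨by omega, by omega, ?_⟩))
          rcases u with _ | ⟨a', u⟩
          · rcases List.eq_nil_or_concat v with rfl | ⟨v, b', rfl⟩
            · have h3 := congrArg List.length hl
              simp at h3
              exact absurd h3 hm
            · rw [List.concat_eq_append] at *
              refine ⟨d, x :: e :: v, b', by simp, by simp, ?_⟩
              have h3 : d :: ((e :: v) ++ [b']) = a :: (m ++ [b]) := by simpa using hl
              rw [List.cons_eq_cons] at h3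
              obtain ⟨rfl, h3⟩ := h3
              have := List.append_inj_right' h3 rfl
              simp at this
              simp [this, hab]
          · obtain ⟨w, b', hw⟩ : ∃ w b', e :: v = w ++ [b'] := by
              rcases List.eq_nil_or_concat (e :: v) with h | ⟨w, b', h⟩
              · simp at h
              · exact ⟨w, b', by simpa using h⟩
            refine ⟨a', u ++ d :: x :: w, b', by simp, by simp [hw], ?_⟩
            rw [hw] at hl
            have h3 : a' :: ((u ++ d :: w) ++ [b']) = a :: (m ++ [b]) := by simpa using hl
            rw [List.cons_eq_cons] at h3
            obtain ⟨rfl, h3⟩ := h3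
            have := List.append_inj_right' h3 rfl
            simp at this
            simp [this, hab]

theorem erase_elem {u v : List ι} {x : ι} (h : SweepState B (u ++ x :: v) E) :
    ∃ E', E ⊆ E' ∧ SweepState B (u ++ v) E' := by
  have hnd : (u ++ v).Nodup := by
    have := h.nodup
    rw [List.nodup_middle, List.nodup_cons] at this
    exact this.2
  have hsub : ∀ a ∈ u ++ v, a ∈ B := by
    intro a ha
    have := h.subset a
    simp only [List.mem_append, List.mem_cons] at ha this ⊢
    tauto
  have hlen := h.length_le
  have hb := h.bound
  have hc := h.chain
  rcases List.eq_nil_or_concat u with rfl | ⟨u, d, rfl⟩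
  · refine ⟨E, subset_rfl, hnd, hsub, ?_, ?_⟩
    · simpa using hc.tail
    · simp only [List.nil_append, List.length_cons] at *
      rcases hb with hb | hb | hb | ⟨h1, h2, a, m, b, hm, hl, -⟩
      · omega
      · omega
      · omega
      · have h3 := congrArg List.length hl
        have := List.length_pos_of_ne_nil hm
        simp only [List.length_append, List.length_cons, List.length_nil] at h3
        omega
  · rw [List.concat_eq_append] at *
    rcases v with _ | ⟨e, v⟩
    · refine ⟨E, subset_rfl, hnd, hsub, ?_, ?_⟩
      · rw [List.append_nil]
        exact (List.isChain_append.1 hc).1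
      · simp only [List.append_nil, List.length_append, List.length_cons, List.length_nil] at *
        rcases hb with hb | hb | hb | ⟨h1, h2, a, m, b, hm, hl, -⟩
        · omega
        · omega
        · omega
        · have := congrArg List.length hl
          have := List.length_pos_of_ne_nil hm
          simp at *
          omega
    · rw [List.append_assoc, List.singleton_append, List.isChain_append_cons_cons,
        List.isChain_cons_cons] at hc
      have hchain : ∀ E', E ⊆ E' → (d, e) ∈ E' →
          (u ++ [d] ++ e :: v).IsChain (fun a b => (a, b) ∈ E') := by
        intro E' hE' hde
        rw [List.append_assoc, List.singleton_append, List.isChain_append_cons_cons]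
        exact ⟨hc.1.imp fun a b => @hE' _, hde, hc.2.2.2.imp fun a b => @hE' _⟩
      have hE : (insert (d, e) E).card ≤ E.card + 1 := Finset.card_insert_le _ _
      simp only [List.length_append, List.length_cons, List.length_nil] at hlen hb
      by_cases hde : (d, e) ∈ E
      · refine ⟨E, subset_rfl, hnd, hsub, hchain E subset_rfl hde, ?_⟩
        simp only [List.length_append, List.length_cons, List.length_nil]
        omega
      · refine ⟨insert (d, e) E, Finset.subset_insert _ _, hnd, hsub,
          hchain _ (Finset.subset_insert _ _) (by simp), ?_⟩
        simp only [List.length_append, List.length_cons, List.length_nil]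
        rcases hb with hb | hb | hb | ⟨h1, h2, a, m, b, hm, hl, hab⟩
        · omega
        · omega
        · omega
        · refine Or.inr (Or.inr (Or.inr ⟨by omega, by omega, ?_⟩))
          rcases u with _ | ⟨a', u⟩
          · rcases List.eq_nil_or_concat v with rfl | ⟨v, b', rfl⟩
            · have h3 : d :: ([x] ++ [e]) = a :: (m ++ [b]) := by simpa using hl
              rw [List.cons_eq_cons] at h3
              obtain ⟨rfl, h3⟩ := h3
              have := List.append_inj_right' h3 rfl
              simp at this
              exact absurd (this ▸ hab) hde
            · rw [List.concat_eq_append] at *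
              refine ⟨d, e :: v, b', by simp, by simp, ?_⟩
              have h3 : d :: ((x :: e :: v) ++ [b']) = a :: (m ++ [b]) := by simpa using hl
              rw [List.cons_eq_cons] at h3
              obtain ⟨rfl, h3⟩ := h3
              have := List.append_inj_right' h3 rfl
              simp at this
              simp [this, hab]
          · obtain ⟨w, b', hw⟩ : ∃ w b', e :: v = w ++ [b'] := by
              rcases List.eq_nil_or_concat (e :: v) with h | ⟨w, b', h⟩
              · simp at h
              · exact ⟨w, b', by simpa using h⟩
            refine ⟨a', u ++ d :: w, b', by simp, by simp [hw], ?_⟩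
            rw [hw] at hl
            have h3 : a' :: ((u ++ d :: x :: w) ++ [b']) = a :: (m ++ [b]) := by simpa using hl
            rw [List.cons_eq_cons] at h3
            obtain ⟨rfl, h3⟩ := h3
            have := List.append_inj_right' h3 rfl
            simp at this
            simp [this, hab]

theorem of_sublist {l' : List ι} (h : SweepState B l E) (hl : l'.Sublist l) :
    ∃ E', E ⊆ E' ∧ SweepState B l' E' := by
  suffices H : ∀ u : List ι, SweepState B (u ++ l) E → ∃ E', E ⊆ E' ∧ SweepState B (u ++ l') E' from
    H [] h
  clear h
  induction hl generalizing E with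
  | slnil => exact fun u h => ⟨E, subset_rfl, h⟩
  | cons x _ ih =>
    intro u h
    obtain ⟨E₁, h₁, h⟩ := h.erase_elem
    obtain ⟨E₂, h₂, h⟩ := ih u h
    exact ⟨E₂, h₁.trans h₂, h⟩
  | cons_cons x _ ih =>
    intro u h
    simpa using ih (u ++ [x]) (by simpa using h)

theorem of_superlist {l' : List ι} (h : SweepState B l E) (hl : l.Sublist l') (hnd : l'.Nodup)
    (hB : ∀ a ∈ l', a ∈ B → a ∈ l) :
    ∃ E', E ⊆ E' ∧ SweepState (B ∪ l'.toFinset) l' E' := by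
  suffices H : ∀ u : List ι, (∀ a ∈ u, a ∈ B) → SweepState B (u ++ l) E →
      ∃ E', E ⊆ E' ∧ SweepState (B ∪ l'.toFinset) (u ++ l') E' from H [] (by simp) h
  clear h
  induction hl generalizing B E with
  | slnil => exact fun u _ h => ⟨E, subset_rfl, by simpa using h⟩
  | @cons l l' x hl ih =>
    intro u hu h
    rw [List.nodup_cons] at hnd
    have hx : x ∉ B := fun hx => hnd.1 (hl.subset (hB x (by simp) hx))
    obtain ⟨E₁, h₁, h⟩ := h.insert_elem hx
    obtain ⟨E₂, h₂, h⟩ := ih (B := insert x B) hnd.2 (by grind) (u ++ [x]) (by grind)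
      (by simpa using h)
    refine ⟨E₂, h₁.trans h₂, ?_⟩
    have : B ∪ (x :: l').toFinset = insert x B ∪ l'.toFinset := by ext; simp
    rw [this]
    simpa using h
  | @cons_cons l l' x _ ih =>
    intro u hu h
    rw [List.nodup_cons] at hnd
    have hx : x ∈ B := h.subset x (by simp)
    obtain ⟨E₂, h₂, h⟩ := ih (B := B) hnd.2 (by grind) (u ++ [x]) (by grind) (by simpa using h)
    refine ⟨E₂, h₂, ?_⟩
    have : B ∪ (x :: l').toFinset = B ∪ l'.toFinset := by ext; simp; grind
    rw [this]
    simpa using h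

end SweepState

section Sweep

variable {V : Type*} [NormedAddCommGroup V] [NormedSpace ℝ V]

/-- Some vertical segment (a fibre of `τ`, with height `η`) leads upwards from `A` to `B`. -/
def Below (τ η : V →L[ℝ] ℝ) (A B : Set V) : Prop :=
  ∃ p ∈ A, ∃ q ∈ B, τ p = τ q ∧ η p < η q

/-- At time `t` a vertical segment leads upwards from `U a` to `U b` without meeting any other
member of the family `U`. -/
def Consecutive {ι : Type*} (τ η : V →L[ℝ] ℝ) (U : ι → Set V) (a b : ι) (t : ℝ) : Prop :=
  a ≠ b ∧ ∃ p ∈ U a, ∃ q ∈ U b, τ p = t ∧ τ q = t ∧ η p < η q ∧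
    ∀ c, ∀ r ∈ U c, τ r = t → η p < η r → η r < η q → c = a ∨ c = b

variable {τ η : V →L[ℝ] ℝ}

theorem Below.lt_of_disjoint (hinj : ∀ v, τ v = 0 → η v = 0 → v = 0) {A B : Set V}
    (hA : Convex ℝ A) (hB : Convex ℝ B) (hAB : Disjoint A B) (h : Below τ η A B)
    {p q : V} (hp : p ∈ A) (hq : q ∈ B) (hpq : τ p = τ q) : η p < η q := by
  obtain ⟨p', hp', q', hq', hτ, hη⟩ := h
  by_contra! hle
  set a := η q' - η p' with ha
  set b := η p - η q with hb
  have hpos : 0 < a + b := by linarith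
  have ha0 : 0 ≤ a / (a + b) := div_nonneg (by linarith) hpos.le
  have hb0 : 0 ≤ b / (a + b) := div_nonneg (by linarith) hpos.le
  have hsum : a / (a + b) + b / (a + b) = 1 := by rw [← add_div, div_self hpos.ne']
  have h1 := hA hp hp' ha0 hb0 hsum
  have h2 := hB hq hq' ha0 hb0 hsum
  refine Set.disjoint_left.1 hAB h1 ?_
  have hz : (a / (a + b)) • p + (b / (a + b)) • p' - ((a / (a + b)) • q + (b / (a + b)) • q') = 0 := by
    apply hinj
    · simp only [map_sub, map_add, map_smul, smul_eq_mul, hpq, hτ]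
      ring
    · simp only [map_sub, map_add, map_smul, smul_eq_mul]
      field_simp
      simp only [ha, hb]
      ring
  rw [sub_eq_zero.1 hz]
  exact h2

variable {ι : Type*} {U : ι → Set V}

theorem Below.asymm (hinj : ∀ v, τ v = 0 → η v = 0 → v = 0) {A B : Set V}
    (hA : Convex ℝ A) (hB : Convex ℝ B) (hAB : Disjoint A B) (h : Below τ η A B) :
    ¬ Below τ η B A := by
  rintro ⟨p, hp, q, hq, h1, h2⟩
  exact absurd (h.lt_of_disjoint hinj hA hB hAB hq hp h1.symm) h2.asymm

theorem exists_sorted_list [Fintype ι] (hinj : ∀ v, τ v = 0 → η v = 0 → v = 0)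
    (hdisj : Pairwise fun a b => Disjoint (U a) (U b)) (t : ℝ) :
    ∃ l : List ι, l.Nodup ∧ (∀ a, a ∈ l ↔ t ∈ τ '' U a) ∧
      l.Pairwise fun a b => Below τ η (U a) (U b) := by
  classical
  have hex : ∀ a, ∃ p : V, t ∈ τ '' U a → p ∈ U a ∧ τ p = t := fun a => by
    by_cases h : t ∈ τ '' U a
    · obtain ⟨p, hp⟩ := h
      exact ⟨p, fun _ => hp⟩
    · exact ⟨0, fun h' => absurd h' h⟩
  choose p hp using hex
  let r : ι → ι → Prop := fun a b => η (p a) ≤ η (p b)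
  have : Std.Total r := ⟨fun a b => le_total _ _⟩
  have : IsTrans ι r := ⟨fun a b c => le_trans⟩
  let l₀ := (Finset.univ.filter fun a => t ∈ τ '' U a).toList
  have hperm : (l₀.insertionSort r).Perm l₀ := List.perm_insertionSort r l₀
  have hmem : ∀ a, a ∈ l₀.insertionSort r ↔ t ∈ τ '' U a := fun a => by
    rw [hperm.mem_iff]
    simp [l₀]
  have hnd : (l₀.insertionSort r).Nodup := hperm.nodup_iff.2 (Finset.nodup_toList _)
  refine ⟨l₀.insertionSort r, hnd, hmem, ?_⟩
  refine ((List.pairwise_insertionSort r l₀).and hnd).imp_of_mem ?_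
  rintro a b ha hb ⟨hab, hne⟩
  obtain ⟨ha1, ha2⟩ := hp a ((hmem a).1 ha)
  obtain ⟨hb1, hb2⟩ := hp b ((hmem b).1 hb)
  refine ⟨p a, ha1, p b, hb1, ha2.trans hb2.symm, lt_of_le_of_ne hab fun h => ?_⟩
  have : p a - p b = 0 := hinj _ (by rw [map_sub, ha2, hb2, sub_self]) (by rw [map_sub, h, sub_self])
  rw [sub_eq_zero] at this
  exact Set.disjoint_left.1 (hdisj hne) ha1 (this ▸ hb1)

theorem Consecutive.mem_of_isChain (hinj : ∀ v, τ v = 0 → η v = 0 → v = 0)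
    (hconv : ∀ a, Convex ℝ (U a)) (hdisj : Pairwise fun a b => Disjoint (U a) (U b))
    {t : ℝ} {l : List ι} (hmem : ∀ a, a ∈ l ↔ t ∈ τ '' U a)
    (hl : l.Pairwise fun a b => Below τ η (U a) (U b)) (hnd : l.Nodup) {E : Finset (ι × ι)}
    (hE : l.IsChain fun a b => (a, b) ∈ E) {a b : ι} (h : Consecutive τ η U a b t) :
    (a, b) ∈ E := by
  obtain ⟨hne, p, hp, q, hq, hpt, hqt, hpq, hbetween⟩ := h
  have hab : Below τ η (U a) (U b) := ⟨p, hp, q, hq, hpt.trans hqt.symm, hpq⟩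
  have ha : a ∈ l := (hmem a).2 ⟨p, hp, hpt⟩
  have hb : b ∈ l := (hmem b).2 ⟨q, hq, hqt⟩
  obtain ⟨u, v, rfl⟩ := List.append_of_mem ha
  have hbv : b ∈ v := by
    rcases List.mem_append.1 hb with h | h
    · have := (List.pairwise_append.1 hl).2.2 b h a List.mem_cons_self
      exact absurd this (hab.asymm hinj (hconv a) (hconv b) (hdisj hne))
    · exact (List.mem_cons.1 h).resolve_left hne.symm
  obtain ⟨x, y, rfl⟩ := List.append_of_mem hbv
  cases x with
  | nil => exact (List.isChain_append_cons_cons.1 hE).2.1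
  | cons z x =>
    have hz : z ∈ u ++ a :: (z :: x ++ b :: y) := by simp
    obtain ⟨w, hw, hwt⟩ := (hmem z).1 hz
    have hpw := (List.pairwise_append.1 hl).2.1
    rw [List.pairwise_cons] at hpw
    have haz := hpw.1 z (by simp)
    have hzb : Below τ η (U z) (U b) := by
      have := hpw.2
      rw [List.cons_append, List.pairwise_cons] at this
      exact this.1 b (by simp)
    have hn := (List.nodup_append.1 hnd).2.1
    simp only [List.nodup_cons, List.mem_append, List.mem_cons, List.cons_append, not_or] at hn
    have h1 := haz.lt_of_disjoint hinj (hconv a) (hconv z) (hdisj (by tauto)) hp hw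
      (hpt.trans hwt.symm)
    have h2 := hzb.lt_of_disjoint hinj (hconv z) (hconv b) (hdisj (by tauto)) hw hq
      (hwt.trans hqt.symm)
    rcases hbetween z w hw hwt h1 h2 with h | h
    · exact absurd h.symm hn.1.1
    · exact absurd h hn.2.1.2.1

/-- A planar family of `n ≥ 3` disjoint convex sets has, at any finite set of times, at most
`3 * n - 6` pairs of vertically consecutive members. -/
theorem exists_sweepState [Fintype ι] [DecidableEq ι] (hinj : ∀ v, τ v = 0 → η v = 0 → v = 0)
    (hconv : ∀ a, Convex ℝ (U a)) (hdisj : Pairwise fun a b => Disjoint (U a) (U b))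
    (T : Finset ℝ) : ∃ B l E, SweepState B l E ∧ (∀ a ∈ B, ∃ s ∈ T, s ∈ τ '' U a) ∧
      (∀ a ∈ B, ∀ t, (∀ s ∈ T, s < t) → t ∈ τ '' U a → a ∈ l) ∧
      (l.Pairwise fun a b => Below τ η (U a) (U b)) ∧
      ∀ t ∈ T, ∀ a b, Consecutive τ η U a b t → (a, b) ∈ E := by
  classical
  induction T using Finset.induction_on_max with
  | empty => exact ⟨∅, [], ∅, SweepState.empty, by simp⟩
  | insert t T ht ih =>
    obtain ⟨B, l, E, hS, hB, hBl, hl, hE⟩ := ih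
    obtain ⟨l', hnd', hmem', hl'⟩ := exists_sorted_list (η := η) hinj hdisj t
    obtain ⟨E₁, hE₁, hS₁⟩ := hS.of_sublist (List.filter_sublist (p := fun a => t ∈ τ '' U a) (l := l))
    have hnd₁ := hS₁.nodup
    have hl₁ := hl.sublist (List.filter_sublist (p := fun a => t ∈ τ '' U a) (l := l))
    have hmem₁ : ∀ a, a ∈ l.filter (fun a => t ∈ τ '' U a) ↔ a ∈ l ∧ t ∈ τ '' U a := by simp
    generalize l.filter (fun a => t ∈ τ '' U a) = l₁ at *
    have hsub : l₁.Sublist l' := by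
      let r : ι → ι → Prop := fun a b => a ≠ b ∧ Below τ η (U a) (U b)
      have : Std.Antisymm r := ⟨fun a b h1 h2 => absurd h2.2
        (h1.2.asymm hinj (hconv a) (hconv b) (hdisj h1.1))⟩
      refine List.sublist_of_subperm_of_pairwise (r := r) ?_ (hnd₁.and hl₁) (hnd'.and hl')
      exact List.subperm_of_subset hnd₁ fun a ha => (hmem' a).2 ((hmem₁ a).1 ha).2
    obtain ⟨E₂, hE₂, hS₂⟩ := hS₁.of_superlist hsub hnd' fun a ha haB =>
      (hmem₁ a).2 ⟨hBl a haB t ht ((hmem' a).1 ha), (hmem' a).1 ha⟩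
    refine ⟨_, l', E₂, hS₂, ?_, ?_, hl', ?_⟩
    · intro a ha
      rcases Finset.mem_union.1 ha with h | h
      · obtain ⟨s, hs, hs'⟩ := hB a h
        exact ⟨s, Finset.mem_insert_of_mem hs, hs'⟩
      · exact ⟨t, Finset.mem_insert_self _ _, (hmem' a).1 (List.mem_toFinset.1 h)⟩
    · intro a ha t' ht' hat'
      rcases Finset.mem_union.1 ha with h | h
      · obtain ⟨s, hs, hs'⟩ := hB a h
        have hc : Convex ℝ (τ '' U a) := (hconv a).linear_image (τ : V →ₗ[ℝ] ℝ)
        exact (hmem' a).2 (hc.ordConnected.out hs' hat'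
          ⟨(ht s hs).le, (ht' t (Finset.mem_insert_self _ _)).le⟩)
      · exact List.mem_toFinset.1 h
    · intro s hs a b hab
      rcases Finset.mem_insert.1 hs with rfl | h
      · exact hab.mem_of_isChain hinj hconv hdisj hmem' hl' hnd' hS₂.chain
      · exact hE₂ (hE₁ (hE s h a b hab))

theorem card_le_of_forall_consecutive [Fintype ι] [DecidableEq ι]
    (hinj : ∀ v, τ v = 0 → η v = 0 → v = 0)
    (hconv : ∀ a, Convex ℝ (U a)) (hdisj : Pairwise fun a b => Disjoint (U a) (U b))
    {m : ℕ} (hm : 3 ≤ m) (hι : Fintype.card ι ≤ m) {F : Finset (ι × ι)}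
    (hF : ∀ e ∈ F, ∃ t, Consecutive τ η U e.1 e.2 t) : F.card ≤ 3 * m - 6 := by
  choose! t ht using hF
  obtain ⟨B, l, E, hS, -, -, -, hE⟩ :=
    exists_sweepState (η := η) (U := U) hinj hconv hdisj (F.image t)
  refine (Finset.card_le_card fun e he => ?_).trans
    (hS.card_le ((Finset.card_le_univ B).trans hι) hm)
  exact hE (t e) (Finset.mem_image_of_mem t he) e.1 e.2 (ht e he)

end Sweep

section Separation

variable {V : Type*} [NormedAddCommGroup V] [NormedSpace ℝ V]

/-- The hyperplane `f = c` strictly separates `A` (on its positive side) from `B`. -/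
def Separates (f : V →L[ℝ] ℝ) (c : ℝ) (A B : Set V) : Prop :=
  (∀ x ∈ A, c < f x) ∧ ∀ x ∈ B, f x < c

/-- All hyperplanes strictly separating `A` from `B` coincide. -/
def UniquelySeparated (A B : Set V) : Prop :=
  ∀ f c f' c', Separates f c A B → Separates f' c' A B → {v | f v = c} = {v | f' v = c'}

theorem Separates.symm {f : V →L[ℝ] ℝ} {c : ℝ} {A B : Set V} (h : Separates f c A B) :
    Separates (-f) (-c) B A :=
  ⟨fun x hx => by simpa using h.2 x hx, fun x hx => by simpa using h.1 x hx⟩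

theorem Separates.apply_eq {f : V →L[ℝ] ℝ} {c : ℝ} {A B : Set V} (h : Separates f c A B) {x : V}
    (hA : x ∈ closure A) (hB : x ∈ closure B) : f x = c := by
  refine le_antisymm ?_ ?_
  · exact closure_minimal (fun y hy => (h.2 y hy).le) (isClosed_le f.continuous continuous_const) hB
  · exact closure_minimal (fun y hy => (h.1 y hy).le) (isClosed_le continuous_const f.continuous) hA

theorem UniquelySeparated.exists_mem_closure [ProperSpace V] {A B : Set V}
    (h : UniquelySeparated A B) (hA : Convex ℝ A) (hB : Convex ℝ B) (hAb : Bornology.IsBounded A)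
    (hAn : A.Nonempty) (hBn : B.Nonempty) : ∃ x, x ∈ closure A ∧ x ∈ closure B := by
  by_contra! hcon
  obtain ⟨f, s, t, hfA, hst, hfB⟩ := geometric_hahn_banach_compact_closed hA.closure
    hAb.isCompact_closure hB.closure isClosed_closure (Set.disjoint_left.2 hcon)
  have hs : Separates (-f) (-s) A B :=
    ⟨fun x hx => by simpa using hfA x (subset_closure hx),
      fun x hx => by simpa using hst.trans (hfB x (subset_closure hx))⟩
  have ht : Separates (-f) (-t) A B :=
    ⟨fun x hx => by simpa using (hfA x (subset_closure hx)).trans hst,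
      fun x hx => by simpa using hfB x (subset_closure hx)⟩
  have heq := h _ _ _ _ hs ht
  obtain ⟨a, ha⟩ := hAn
  obtain ⟨b, hb⟩ := hBn
  have ha' := hfA a (subset_closure ha)
  have hb' := hfB b (subset_closure hb)
  have hne : f (b - a) ≠ 0 := by rw [map_sub]; linarith
  have hz : (s / f (b - a)) • (b - a) ∈ {v | (-f) v = -s} := by
    simp [div_mul_cancel₀ _ hne, -map_sub]
  rw [heq] at hz
  have : s = t := by simpa [div_mul_cancel₀ _ hne, -map_sub] using hz
  linarith

/-- `τ` and `η` are linear coordinates of a plane, dual to the basis `u`, `w`. -/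
structure PlaneCoords (τ η : V →L[ℝ] ℝ) (u w : V) : Prop where
  decomp : ∀ v, v = τ v • u + η v • w
  fst_u : τ u = 1
  fst_w : τ w = 0
  snd_u : η u = 0
  snd_w : η w = 1

/-- Inside `A`, to the right of `x`, the functional `h` is not bounded below by a positive
multiple of the distance to `x` along the coordinate `τ`. -/
def RightTangent (τ h : V →L[ℝ] ℝ) (A : Set V) (x : V) : Prop :=
  ∀ ε > 0, ∃ p ∈ A, 0 < τ (p - x) ∧ h (p - x) < ε * τ (p - x)

namespace PlaneCoords

variable {τ η : V →L[ℝ] ℝ} {u w : V}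

theorem neg_fst (hc : PlaneCoords τ η u w) : PlaneCoords (-τ) η (-u) w :=
  ⟨fun v => by simpa using hc.decomp v, by simp [hc.fst_u], by simp [hc.fst_w],
    by simp [hc.snd_u], hc.snd_w⟩

theorem neg_snd (hc : PlaneCoords τ η u w) : PlaneCoords τ (-η) u (-w) :=
  ⟨fun v => by simpa using hc.decomp v, hc.fst_u, by simp [hc.fst_w],
    by simp [hc.snd_u], by simp [hc.snd_w]⟩

theorem apply_eq (hc : PlaneCoords τ η u w) (f : V →L[ℝ] ℝ) (v : V) :
    f v = τ v * f u + η v * f w := by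
  conv_lhs => rw [hc.decomp v]
  simp

theorem eq_zero (hc : PlaneCoords τ η u w) (v : V) (h1 : τ v = 0) (h2 : η v = 0) : v = 0 := by
  rw [hc.decomp v, h1, h2]; simp

theorem sub_eq (hc : PlaneCoords τ η u w) {p q : V} (h : τ p = τ q) :
    p - q = (η p - η q) • w := by
  rw [hc.decomp (p - q)]; simp [h]

theorem mul_sub_mul (hc : PlaneCoords τ η u w) (g h : V →L[ℝ] ℝ) (v : V) :
    g v * h w - h v * g w = τ v * (g u * h w - h u * g w) := by
  rw [hc.apply_eq g v, hc.apply_eq h v]; ring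

theorem rightTangent_or (hc : PlaneCoords τ η u w) {h : V →L[ℝ] ℝ} {c : ℝ} {A B : Set V} {x : V}
    (hAB : UniquelySeparated A B) (hh : Separates h c A B) (hw : h w ≠ 0)
    (hx : h x = c) : RightTangent τ h A x ∨ RightTangent (-τ) (-h) B x := by
  by_contra! hcon
  simp only [RightTangent, not_forall, not_exists, not_and, not_lt] at hcon
  obtain ⟨⟨ε, hε, h1⟩, ⟨ε', hε', h2⟩⟩ := hcon
  obtain ⟨δ, hδ, hδ1, hδ2⟩ : ∃ δ > 0, δ < ε ∧ δ < ε' :=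
    ⟨min ε ε' / 2, by positivity, by linarith [min_le_left ε ε', lt_min hε hε'],
      by linarith [min_le_right ε ε', lt_min hε hε']⟩
  have hsep : Separates (h - δ • τ) (c - δ * τ x) A B := by
    constructor
    · intro p hp
      have := hh.1 p hp
      have h3 := h1 p hp
      simp only [map_sub, hx, sub_apply, smul_apply,
        smul_eq_mul] at h3 ⊢
      rcases lt_or_ge 0 (τ p - τ x) with h4 | h4
      · nlinarith [h3 h4]
      · nlinarith
    · intro p hp
      have := hh.2 p hp
      have h3 := h2 p hp
      simp only [map_sub, hx, sub_apply, smul_apply,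
        smul_eq_mul, neg_apply] at h3 ⊢
      rcases lt_or_ge (τ p - τ x) 0 with h4 | h4
      · nlinarith [h3 (by linarith)]
      · nlinarith
  have heq := hAB _ _ _ _ hh hsep
  have hz : x + (u - (h u / h w) • w) ∈ {v | h v = c} := by
    simp [hx, div_mul_cancel₀ _ hw]
  rw [heq] at hz
  simp only [map_add, map_sub, sub_apply, smul_apply,
        smul_eq_mul, map_smul, Set.mem_ofPred_eq, hx, div_mul_cancel₀ _ hw, hc.fst_u, hc.fst_w] at hz
  linarith

end PlaneCoords

end Separation

section Tangent

variable {V : Type*} [NormedAddCommGroup V] [NormedSpace ℝ V]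

open Filter Topology in
theorem eventually_ray_mem {A N : Set V} (hA : Convex ℝ A) (hAo : IsOpen A) {x p : V}
    (hx : x ∈ closure A) (hp : p ∈ A) (hN : N ∈ 𝓝 x) {T : ℝ} (hT : 0 < T) :
    ∀ᶠ t in 𝓝[>] (0 : ℝ), x + (t / T) • (p - x) ∈ A ∧ x + (t / T) • (p - x) ∈ N := by
  have hlim : Tendsto (fun t : ℝ => x + (t / T) • (p - x)) (𝓝[>] 0) (𝓝 x) := by
    have : Continuous fun t : ℝ => x + (t / T) • (p - x) := by fun_prop
    simpa using (this.tendsto 0).mono_left nhdsWithin_le_nhds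
  filter_upwards [hlim hN, Ioc_mem_nhdsGT hT] with t h1 h2
  refine ⟨?_, h1⟩
  rw [← hAo.interior_eq] at hp ⊢
  exact hA.add_smul_sub_mem_interior' hx hp ⟨div_pos h2.1 hT, (div_le_one hT).2 h2.2⟩

namespace PlaneCoords

variable {τ η : V →L[ℝ] ℝ} {u w : V} {ι : Type*} {U : ι → Set V}

theorem below_of_separates (hc : PlaneCoords τ η u w) {h : V →L[ℝ] ℝ} {c : ℝ} {A B : Set V}
    (hh : Separates h c A B) (hw : 0 < h w) {p q : V} (hp : p ∈ A) (hq : q ∈ B)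
    (hpq : τ p = τ q) : η q < η p := by
  have h1 := hh.1 p hp
  have h2 := hh.2 q hq
  have h3 : h (p - q) = (η p - η q) * h w := by rw [hc.sub_eq hpq]; simp
  rw [map_sub] at h3
  by_contra! hle
  nlinarith

open Topology in
/-- Two disjoint sets accumulating at `x` and having points to the right of `x` have points near
`x` on a common vertical line. -/
theorem exists_near {A B N : Set V} (hA : Convex ℝ A) (hAo : IsOpen A)
    (hB : Convex ℝ B) (hBo : IsOpen B) {x : V} (hxA : x ∈ closure A) (hxB : x ∈ closure B)
    (hN : N ∈ 𝓝 x) {p q : V} (hp : p ∈ A) (hq : q ∈ B) (hpx : 0 < τ (p - x))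
    (hqx : 0 < τ (q - x)) :
    ∃ a > (0 : ℝ), ∃ b > (0 : ℝ), x + a • (p - x) ∈ A ∩ N ∧ x + b • (q - x) ∈ B ∩ N ∧
      τ (x + a • (p - x)) = τ (x + b • (q - x)) := by
  obtain ⟨t, ⟨h1, h2⟩, ht⟩ := (((eventually_ray_mem hA hAo hxA hp hN hpx).and
    (eventually_ray_mem hB hBo hxB hq hN hqx)).and self_mem_nhdsWithin).exists
  refine ⟨t / τ (p - x), div_pos ht hpx, t / τ (q - x), div_pos ht hqx, h1, h2, ?_⟩
  rw [map_add, map_add, map_smul, map_smul, smul_eq_mul, smul_eq_mul, div_mul_cancel₀ _ hpx.ne',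
    div_mul_cancel₀ _ hqx.ne']

open Topology in
/-- Just below a set `U i` accumulating at `x`, to the right of `x`, there is another member of
the family that accumulates at `x`. -/
theorem exists_consecutive_below [Finite ι] (hc : PlaneCoords τ η u w)
    (hopen : ∀ a, IsOpen (U a)) (hconv : ∀ a, Convex ℝ (U a))
    (hdisj : Pairwise fun a b => Disjoint (U a) (U b)) {i j : ι} (hij : i ≠ j) {x : V}
    (hxi : x ∈ closure (U i)) (hxj : x ∈ closure (U j)) (hji : Below τ η (U j) (U i)) {p q : V}
    (hp : p ∈ U i) (hq : q ∈ U j) (hpx : 0 < τ (p - x)) (hqx : 0 < τ (q - x)) :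
    ∃ k t, Consecutive τ η U k i t ∧ x ∈ closure (U k) ∧ (k = j ∨ k ≠ j ∧ Below τ η (U j) (U k)) ∧
      ∃ r ∈ U k, 0 < τ (r - x) := by
  have hN : ∀ᶠ v in 𝓝 x, ∀ k, x ∉ closure (U k) → v ∉ U k := by
    rw [Filter.eventually_all]
    intro k
    by_cases hk : x ∈ closure (U k)
    · simp [hk]
    · filter_upwards [isClosed_closure.isOpen_compl.mem_nhds hk] with v hv _ hvk
      exact hv (subset_closure hvk)
  obtain ⟨r, hr, hball⟩ := Metric.eventually_nhds_iff_ball.1 hN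
  obtain ⟨a, ha, b, hb, ⟨hP, hPr⟩, ⟨hQ, hQr⟩, hPQ⟩ := exists_near (hconv i) (hopen i)
    (hconv j) (hopen j) hxi hxj (Metric.ball_mem_nhds x hr) hp hq hpx hqx
  set P := x + a • (p - x) with hPdef
  set Q := x + b • (q - x)
  have hPx : τ x < τ P := by
    have := mul_pos ha hpx
    rw [hPdef, map_add, map_smul, smul_eq_mul]
    linarith
  have hlt := hji.lt_of_disjoint hc.eq_zero (hconv j) (hconv i) (hdisj hij.symm) hQ hP hPQ.symm
  let K := {k : ι // k ≠ i ∧ ∃ z ∈ U k, τ z = τ P ∧ η Q ≤ η z ∧ η z < η P}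
  have : Nonempty K := ⟨⟨j, hij.symm, Q, hQ, hPQ.symm, le_rfl, hlt⟩⟩
  choose z hzk hzτ hzQ hzP using fun k : K => k.2.2
  obtain ⟨⟨k, hk⟩, hmax⟩ := Finite.exists_max fun k : K => η (z k)
  set Z := z ⟨k, hk⟩ with hZ
  have hZk : Z ∈ U k := hzk ⟨k, hk⟩
  have hZτ : τ Z = τ P := hzτ ⟨k, hk⟩
  have hZQ : η Q ≤ η Z := hzQ ⟨k, hk⟩
  have hZP : η Z < η P := hzP ⟨k, hk⟩
  refine ⟨k, τ P, ⟨hk.1, Z, hZk, P, hP, hZτ, rfl, hZP, ?_⟩, ?_, ?_, Z, hZk, ?_⟩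
  · intro c y hy hyτ hZy hyP
    by_contra! hcon
    have hcK : c ≠ i ∧ ∃ z ∈ U c, τ z = τ P ∧ η Q ≤ η z ∧ η z < η P :=
      ⟨hcon.2, y, hy, hyτ, hZQ.trans hZy.le, hyP⟩
    have h1 : Below τ η (U k) (U c) := ⟨Z, hZk, y, hy, hZτ.trans hyτ.symm, hZy⟩
    have h2 := h1.lt_of_disjoint hc.eq_zero (hconv k) (hconv c) (hdisj hcon.1.symm) hZk
      (hzk ⟨c, hcK⟩) (hZτ.trans (hzτ ⟨c, hcK⟩).symm)
    exact absurd (hmax ⟨c, hcK⟩) (not_le.2 h2)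
  · by_contra hxk
    refine hball Z ?_ k hxk hZk
    refine (convex_ball x r).segment_subset hQr hPr ?_
    have hpos : 0 < η P - η Q := by linarith
    refine ⟨(η P - η Z) / (η P - η Q), (η Z - η Q) / (η P - η Q),
      div_nonneg (by linarith) hpos.le, div_nonneg (by linarith) hpos.le, ?_, ?_⟩
    · rw [← add_div, div_eq_one_iff_eq hpos.ne']; ring
    · rw [← sub_eq_zero]
      apply hc.eq_zero
      · simp only [map_sub, map_add, map_smul, smul_eq_mul, hZτ, ← hPQ]
        field_simp
        ring
      · simp only [map_sub, map_add, map_smul, smul_eq_mul]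
        field_simp
        ring
  · rcases eq_or_ne k j with h | h
    · exact Or.inl h
    · refine Or.inr ⟨h, Q, hQ, Z, hZk, hPQ.symm.trans hZτ.symm, lt_of_le_of_ne hZQ fun heq => ?_⟩
      have : Q - Z = 0 := hc.eq_zero _ (by rw [map_sub, ← hPQ, hZτ, sub_self])
        (by rw [map_sub, heq, sub_self])
      rw [sub_eq_zero] at this
      exact Set.disjoint_left.1 (hdisj h) hZk (this ▸ hQ)
  · rw [map_sub, hZτ]; linarith

theorem exists_consecutive_of_rightTangent [Finite ι] (hc : PlaneCoords τ η u w)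
    (hopen : ∀ a, IsOpen (U a)) (hconv : ∀ a, Convex ℝ (U a))
    (hdisj : Pairwise fun a b => Disjoint (U a) (U b)) {i j : ι} (hij : i ≠ j)
    {h : V →L[ℝ] ℝ} {c : ℝ} {x : V} (hh : Separates h c (U i) (U j)) (hw : 0 < h w)
    (hxi : x ∈ closure (U i)) (hxj : x ∈ closure (U j)) (hR : RightTangent τ h (U i) x)
    (hLR : RightTangent (-τ) h (U i) x ∨ RightTangent τ (-h) (U j) x)
    {q : V} (hq : q ∈ U j) (hqx : 0 < τ (q - x)) :
    ∃ k t, Consecutive τ η U k i t ∧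
      ∀ g d, Separates g d (U i) (U k) → {v | g v = d} = {v | h v = c} := by
  obtain ⟨p, hp, hpx, -⟩ := hR 1 one_pos
  have hji : Below τ η (U j) (U i) := by
    obtain ⟨a, -, b, -, hP, hQ, hPQ⟩ := exists_near (hconv i) (hopen i)
      (hconv j) (hopen j) hxi hxj Filter.univ_mem hp hq hpx hqx
    exact ⟨_, hQ.1, _, hP.1, hPQ.symm, hc.below_of_separates hh hw hP.1 hQ.1 hPQ⟩
  obtain ⟨k, t, hki, hxk, hkj, r, hr, hrx⟩ :=
    hc.exists_consecutive_below hopen hconv hdisj hij hxi hxj hji hp hq hpx hqx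
  refine ⟨k, t, hki, fun g d hg => ?_⟩
  obtain rfl := hh.apply_eq hxi hxj
  obtain rfl := hg.apply_eq hxi hxk
  have hgw : 0 < g w := by
    obtain ⟨-, z, hz, y, hy, hzt, hyt, hzy, -⟩ := hki
    have h1 := (hg.2 z hz).trans (hg.1 y hy)
    have h2 : g (y - z) = (η y - η z) * g w := by rw [hc.sub_eq (hyt.trans hzt.symm)]; simp
    rw [map_sub] at h2
    by_contra! hle
    nlinarith
  have hμ : g u * h w - h u * g w = 0 := by
    apply le_antisymm
    · refine le_of_forall_pos_le_add fun ε hε => ?_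
      rw [zero_add]
      rcases hLR with hL | hRj
      · obtain ⟨y, hy, h1, h2⟩ := hL (ε / g w) (div_pos hε hgw)
        have h3 := hg.1 y hy
        have h4 := hc.mul_sub_mul g h (y - x)
        have h5 : h (y - x) * g w < ε * (-τ) (y - x) := by
          rw [div_mul_eq_mul_div, lt_div_iff₀ hgw] at h2
          exact h2
        have h6 : 0 < g (y - x) * h w := mul_pos (by rw [map_sub]; linarith) hw
        rw [neg_apply] at h1 h5
        by_contra! hlt
        nlinarith
      · obtain ⟨y, hy, h1, h2⟩ := hRj (ε / g w) (div_pos hε hgw)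
        have h3 : g (y - x) < 0 := by
          rcases hkj with rfl | ⟨hjk', hjk⟩
          · rw [map_sub]; linarith [hg.2 y hy]
          · obtain ⟨a, -, b, hb, hP, hQ, hPQ⟩ := exists_near (hconv k) (hopen k)
              (hconv j) (hopen j) hxk hxj Filter.univ_mem hr hy hrx h1
            have h4 := hjk.lt_of_disjoint hc.eq_zero (hconv j) (hconv k) (hdisj hjk'.symm)
              hQ.1 hP.1 hPQ.symm
            have h5 := hg.2 _ hP.1
            have h6 := congrArg g (hc.sub_eq hPQ)
            rw [map_sub, map_smul, smul_eq_mul] at h6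
            have h7 := mul_pos (sub_pos.2 h4) hgw
            rw [map_add g x (b • _), map_smul, smul_eq_mul] at h6
            by_contra! hle
            have := mul_nonneg hb.le hle
            linarith
        have h4 := hc.mul_sub_mul g h (y - x)
        have h5 : (-h) (y - x) * g w < ε * τ (y - x) := by
          rw [div_mul_eq_mul_div, lt_div_iff₀ hgw] at h2
          exact h2
        have h6 : g (y - x) * h w < 0 := mul_neg_of_neg_of_pos h3 hw
        rw [neg_apply] at h5
        by_contra! hlt
        nlinarith
    · refine le_of_forall_pos_le_add fun ε hε => ?_
      obtain ⟨y, hy, h1, h2⟩ := hR (ε / g w) (div_pos hε hgw)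
      have h3 := hg.1 y hy
      have h4 := hc.mul_sub_mul g h (y - x)
      have h5 : h (y - x) * g w < ε * τ (y - x) := by
        rw [div_mul_eq_mul_div, lt_div_iff₀ hgw] at h2
        exact h2
      have h6 : 0 < g (y - x) * h w := mul_pos (by rw [map_sub]; linarith) hw
      by_contra! hlt
      nlinarith
  ext v
  have h1 := hc.mul_sub_mul g h (v - x)
  rw [hμ, mul_zero, map_sub, map_sub] at h1
  simp only [Set.mem_ofPred_eq]
  constructor
  · intro h2
    have : (h v - h x) * g w = 0 := by rw [h2] at h1; linarith
    rcases mul_eq_zero.1 this with h | h <;> linarith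
  · intro h2
    have : (g v - g x) * h w = 0 := by rw [h2] at h1; linarith
    rcases mul_eq_zero.1 this with h | h <;> linarith

end PlaneCoords

end Tangent

section Rigid

variable {V : Type*} [NormedAddCommGroup V] [NormedSpace ℝ V] {τ η : V →L[ℝ] ℝ} {u w : V}
  {ι : Type*} {U : ι → Set V}

theorem Consecutive.of_neg_fst {a b : ι} {t : ℝ} (h : Consecutive (-τ) η U a b t) :
    Consecutive τ η U a b (-t) := by
  obtain ⟨hne, p, hp, q, hq, hpt, hqt, hpq, hb⟩ := h
  simp only [neg_apply] at hpt hqt hb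
  exact ⟨hne, p, hp, q, hq, by linarith, by linarith, hpq,
    fun c r hr hrt => hb c r hr (by linarith)⟩

theorem Consecutive.of_neg_snd {a b : ι} {t : ℝ} (h : Consecutive τ (-η) U a b t) :
    Consecutive τ η U b a t := by
  obtain ⟨hne, p, hp, q, hq, hpt, hqt, hpq, hb⟩ := h
  simp only [neg_apply, neg_lt_neg_iff] at hpq hb
  exact ⟨hne.symm, q, hq, p, hp, hqt, hpt, hpq,
    fun c r hr hrt h1 h2 => (hb c r hr hrt h2 h1).symm⟩

/-- Every hyperplane strictly separating `U a` from `U b`, for a suitable pair of vertically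
consecutive sets, is equal to `ℓ`. -/
def RealizedBy (τ η : V →L[ℝ] ℝ) (U : ι → Set V) (ℓ : Set V) : Prop :=
  ∃ a b t, Consecutive τ η U a b t ∧ ∀ g d, Separates g d (U a) (U b) → {v | g v = d} = ℓ

theorem RealizedBy.of_neg_fst {ℓ : Set V} (h : RealizedBy (-τ) η U ℓ) : RealizedBy τ η U ℓ := by
  obtain ⟨a, b, t, h1, h2⟩ := h
  exact ⟨a, b, -t, h1.of_neg_fst, h2⟩

theorem setOf_neg_apply_eq (g : V →L[ℝ] ℝ) (d : ℝ) : {v | (-g) v = -d} = {v | g v = d} := by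
  ext v; simp

theorem forall_separates_symm {A B ℓ : Set V}
    (h : ∀ g d, Separates g d A B → {v | g v = d} = ℓ) (g : V →L[ℝ] ℝ) (d : ℝ)
    (hg : Separates g d B A) : {v | g v = d} = ℓ := by
  rw [← setOf_neg_apply_eq]
  exact h _ _ hg.symm

theorem RealizedBy.of_neg_snd {ℓ : Set V} (h : RealizedBy τ (-η) U ℓ) : RealizedBy τ η U ℓ := by
  obtain ⟨a, b, t, h1, h2⟩ := h
  exact ⟨b, a, t, h1.of_neg_snd, forall_separates_symm h2⟩

namespace PlaneCoords

variable [Finite ι] {i j : ι} {h : V →L[ℝ] ℝ} {c : ℝ} {x : V}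

theorem realizedBy_of_rightTangent (hc : PlaneCoords τ η u w)
    (hopen : ∀ a, IsOpen (U a)) (hconv : ∀ a, Convex ℝ (U a))
    (hdisj : Pairwise fun a b => Disjoint (U a) (U b)) (hij : i ≠ j)
    (hh : Separates h c (U i) (U j)) (hw : 0 < h w)
    (hxi : x ∈ closure (U i)) (hxj : x ∈ closure (U j)) (hR : RightTangent τ h (U i) x)
    (hLR : RightTangent (-τ) h (U i) x ∨ RightTangent τ (-h) (U j) x)
    {q : V} (hq : q ∈ U j) (hqx : 0 < τ (q - x)) : RealizedBy τ η U {v | h v = c} := by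
  obtain ⟨k, t, hk, hg⟩ :=
    hc.exists_consecutive_of_rightTangent hopen hconv hdisj hij hh hw hxi hxj hR hLR hq hqx
  exact ⟨k, i, t, hk, forall_separates_symm hg⟩

open Filter Topology in
theorem exists_mem_fst_ne (hc : PlaneCoords τ η u w) {A : Set V} (hA : IsOpen A)
    (hne : A.Nonempty) (x : V) : ∃ q ∈ A, τ (q - x) ≠ 0 := by
  obtain ⟨q, hq⟩ := hne
  by_cases h0 : τ (q - x) = 0
  · have hlim : Tendsto (fun t : ℝ => q + t • u) (𝓝[>] 0) (𝓝 q) := by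
      have : Continuous fun t : ℝ => q + t • u := by fun_prop
      simpa using (this.tendsto 0).mono_left nhdsWithin_le_nhds
    obtain ⟨t, h1, h2⟩ := ((hlim.eventually (hA.mem_nhds hq)).and self_mem_nhdsWithin).exists
    refine ⟨_, h1, ?_⟩
    rw [add_sub_right_comm, map_add, h0, map_smul, hc.fst_u]
    simpa using ne_of_gt h2
  · exact ⟨q, hq, h0⟩

theorem realizedBy_of_two_sided (hc : PlaneCoords τ η u w)
    (hopen : ∀ a, IsOpen (U a)) (hconv : ∀ a, Convex ℝ (U a)) (hne : ∀ a, (U a).Nonempty)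
    (hdisj : Pairwise fun a b => Disjoint (U a) (U b)) (hij : i ≠ j)
    (hh : Separates h c (U i) (U j)) (hw : 0 < h w)
    (hxi : x ∈ closure (U i)) (hxj : x ∈ closure (U j)) (hR : RightTangent τ h (U i) x)
    (hL : RightTangent (-τ) h (U i) x) : RealizedBy τ η U {v | h v = c} := by
  obtain ⟨q, hq, hqx⟩ := hc.exists_mem_fst_ne (hopen j) (hne j) x
  rcases hqx.lt_or_gt with hqx | hqx
  · refine (hc.neg_fst.realizedBy_of_rightTangent hopen hconv hdisj hij hh hw hxi hxj hL
      (Or.inl ?_) hq ?_).of_neg_fst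
    · rwa [neg_neg]
    · rw [neg_apply]; linarith
  · exact hc.realizedBy_of_rightTangent hopen hconv hdisj hij hh hw hxi hxj hR (Or.inl hL) hq hqx

theorem realizedBy_of_pos (hc : PlaneCoords τ η u w)
    (hopen : ∀ a, IsOpen (U a)) (hconv : ∀ a, Convex ℝ (U a)) (hne : ∀ a, (U a).Nonempty)
    (hdisj : Pairwise fun a b => Disjoint (U a) (U b)) (hij : i ≠ j)
    (hu : UniquelySeparated (U i) (U j)) (hh : Separates h c (U i) (U j)) (hw : 0 < h w)
    (hxi : x ∈ closure (U i)) (hxj : x ∈ closure (U j)) : RealizedBy τ η U {v | h v = c} := by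
  have hx := hh.apply_eq hxi hxj
  have h1 := hc.rightTangent_or hu hh hw.ne' hx
  have h2 := hc.neg_fst.rightTangent_or hu hh hw.ne' hx
  rw [neg_neg] at h2
  rcases h1 with hRi | hLj <;> rcases h2 with hLi | hRj
  · exact hc.realizedBy_of_two_sided hopen hconv hne hdisj hij hh hw hxi hxj hRi hLi
  · obtain ⟨q, hq, hqx, -⟩ := hRj 1 one_pos
    exact hc.realizedBy_of_rightTangent hopen hconv hdisj hij hh hw hxi hxj hRi (Or.inr hRj) hq hqx
  · obtain ⟨q, hq, hqx, -⟩ := hLj 1 one_pos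
    exact (hc.neg_fst.realizedBy_of_rightTangent hopen hconv hdisj hij hh hw hxi hxj hLi
      (Or.inr hLj) hq hqx).of_neg_fst
  · rw [← setOf_neg_apply_eq]
    exact (hc.neg_snd.realizedBy_of_two_sided hopen hconv hne hdisj hij.symm hh.symm
      (by simpa using hw) hxj hxi hRj hLj).of_neg_snd

/-- In a finite family of disjoint open convex sets, a nonvertical line that is the only one to
separate a certain pair also is the only one to separate a pair of vertically consecutive sets. -/
theorem realizedBy [ProperSpace V] (hc : PlaneCoords τ η u w)
    (hopen : ∀ a, IsOpen (U a)) (hconv : ∀ a, Convex ℝ (U a)) (hne : ∀ a, (U a).Nonempty)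
    (hbdd : ∀ a, Bornology.IsBounded (U a))
    (hdisj : Pairwise fun a b => Disjoint (U a) (U b)) (hij : i ≠ j)
    (hu : UniquelySeparated (U i) (U j)) (hh : Separates h c (U i) (U j)) (hw : h w ≠ 0) :
    RealizedBy τ η U {v | h v = c} := by
  obtain ⟨x, hxi, hxj⟩ := hu.exists_mem_closure (hconv i) (hconv j) (hbdd i) (hne i) (hne j)
  rcases hw.lt_or_gt with hw | hw
  · exact (hc.neg_snd.realizedBy_of_pos hopen hconv hne hdisj hij hu hh (by simpa using hw)
      hxi hxj).of_neg_snd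
  · exact hc.realizedBy_of_pos hopen hconv hne hdisj hij hu hh hw hxi hxj

end PlaneCoords

end Rigid

section Cells

variable {V : Type*} [NormedAddCommGroup V] [NormedSpace ℝ V] {ι : Type*}

/-- A family of pairwise disjoint open convex subsets of `D`. -/
structure IsCellFamily (D : Set V) (U : ι → Set V) : Prop where
  isOpen : ∀ i, IsOpen (U i)
  convex : ∀ i, Convex ℝ (U i)
  subset : ∀ i, U i ⊆ D
  disjoint : Pairwise fun i j => Disjoint (U i) (U j)

theorem IsCellFamily.exists_maximal {D : Set V} {U₀ : ι → Set V} (h : IsCellFamily D U₀) :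
    ∃ U, U₀ ≤ U ∧ Maximal (IsCellFamily D) U := by
  refine zorn_le_nonempty₀ {U | IsCellFamily D U} (fun C hC hchain W hW => ?_) U₀ h
  have hdir : ∀ A ∈ C, ∀ B ∈ C, ∃ E ∈ C, A ≤ E ∧ B ≤ E := fun A hA B hB => by
    rcases hchain.total hA hB with h | h
    · exact ⟨B, hB, h, le_rfl⟩
    · exact ⟨A, hA, le_rfl, h⟩
  refine ⟨fun i => ⋃ A : C, A.1 i, ⟨fun i => ?_, fun i => ?_, fun i => ?_, fun i j hij => ?_⟩,
    fun A hA i => Set.subset_iUnion (fun A : C => A.1 i) ⟨A, hA⟩⟩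
  · exact isOpen_iUnion fun A => (hC A.2).isOpen i
  · refine Directed.convex_iUnion (fun A B => ?_) fun A => (hC A.2).convex i
    obtain ⟨E, hE, h1, h2⟩ := hdir A A.2 B B.2
    exact ⟨⟨E, hE⟩, h1 i, h2 i⟩
  · exact Set.iUnion_subset fun A => (hC A.2).subset i
  · refine Set.disjoint_iUnion_left.2 fun A => Set.disjoint_iUnion_right.2 fun B => ?_
    obtain ⟨E, hE, h1, h2⟩ := hdir A A.2 B B.2
    exact ((hC hE).disjoint hij).mono (h1 i) (h2 j)

/-- The part of `D` on the positive sides of the hyperplanes `f l = c l` with `l ∈ s`. -/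
def polyhedron (D : Set V) (f : ι → V →L[ℝ] ℝ) (c : ι → ℝ) (s : Set ι) : Set V :=
  {p | p ∈ D ∧ ∀ l ∈ s, c l < f l p}

theorem polyhedron_eq (D : Set V) (f : ι → V →L[ℝ] ℝ) (c : ι → ℝ) (s : Set ι) :
    polyhedron D f c s = D ∩ ⋂ l ∈ s, {p | c l < f l p} := by
  ext p; simp [polyhedron]

theorem isOpen_polyhedron [Finite ι] {D : Set V} (hD : IsOpen D) (f : ι → V →L[ℝ] ℝ) (c : ι → ℝ)
    (s : Set ι) : IsOpen (polyhedron D f c s) := by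
  rw [polyhedron_eq]
  exact hD.inter (s.toFinite.isOpen_biInter fun l _ => isOpen_lt continuous_const (f l).continuous)

theorem convex_polyhedron {D : Set V} (hD : Convex ℝ D) (f : ι → V →L[ℝ] ℝ) (c : ι → ℝ)
    (s : Set ι) : Convex ℝ (polyhedron D f c s) := by
  rw [polyhedron_eq]
  exact hD.inter (convex_iInter₂ fun l _ => convex_halfSpace_gt (f l).isLinear (c l))

theorem polyhedron_subset_of_maximal [Finite ι] {D : Set V} (hDo : IsOpen D) (hDc : Convex ℝ D)
    {U : ι → Set V} (hU : Maximal (IsCellFamily D) U) {i : ι} {f : ι → V →L[ℝ] ℝ} {c : ι → ℝ}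
    (hf : ∀ j, j ≠ i → Separates (f j) (c j) (U i) (U j)) :
    polyhedron D f c {j | j ≠ i} ⊆ U i := by
  classical
  set Q := polyhedron D f c {j | j ≠ i} with hQ
  have hUQ : U i ⊆ Q := fun p hp => ⟨hU.prop.subset i hp, fun j hj => (hf j hj).1 p hp⟩
  have hQD : Q ⊆ D := fun p hp => hp.1
  have hle : U ≤ Function.update U i Q := fun j => by
    rcases eq_or_ne j i with rfl | hj
    · simpa using hUQ
    · simp [Function.update_of_ne hj]
  have hQj : ∀ j, j ≠ i → Disjoint Q (U j) := fun j hj => Set.disjoint_left.2 fun p hp hpj =>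
    lt_asymm (hp.2 j hj) ((hf j hj).2 p hpj)
  have hfam : IsCellFamily D (Function.update U i Q) := by
    refine ⟨fun j => ?_, fun j => ?_, fun j => ?_, fun j k hjk => ?_⟩
    · rcases eq_or_ne j i with rfl | hj
      · simpa using isOpen_polyhedron hDo f c _
      · simpa [Function.update_of_ne hj] using hU.prop.isOpen j
    · rcases eq_or_ne j i with rfl | hj
      · simpa using convex_polyhedron hDc f c _
      · simpa [Function.update_of_ne hj] using hU.prop.convex j
    · rcases eq_or_ne j i with rfl | hj
      · simpa using hQD
      · simpa [Function.update_of_ne hj] using hU.prop.subset j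
    · rcases eq_or_ne j i with rfl | hj
      · simpa [Function.update_of_ne hjk.symm] using hQj k hjk.symm
      · rcases eq_or_ne k i with rfl | hk
        · simpa [Function.update_of_ne hj] using (hQj j hj).symm
        · simpa [Function.update_of_ne hj, Function.update_of_ne hk] using hU.prop.disjoint hjk
  simpa using hU.le_of_ge hfam hle i

open Filter Topology in
/-- Two open half-spaces that cut out the same proper nonempty part of an open convex set have the
same boundary. -/
theorem setOf_apply_eq_of_forall_lt_iff {W : Set V} (hWo : IsOpen W) (hWc : Convex ℝ W)
    {f g : V →L[ℝ] ℝ} {c e : ℝ} (hfg : ∀ v ∈ W, c < f v ↔ e < g v) {p q : V} (hp : p ∈ W)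
    (hq : q ∈ W) (hpf : c < f p) (hqf : f q ≤ c) : {v | f v = c} = {v | g v = e} := by
  obtain ⟨z, hz, hfz⟩ : ∃ z ∈ W, f z = c := by
    have hpos : 0 < f p - f q := by linarith
    refine ⟨q + ((c - f q) / (f p - f q)) • (p - q), hWc.add_smul_sub_mem hq hp
      ⟨div_nonneg (by linarith) hpos.le, (div_le_one hpos).2 (by linarith)⟩, ?_⟩
    rw [map_add, map_smul, map_sub, smul_eq_mul, div_mul_cancel₀ _ hpos.ne']
    ring
  have hlim : ∀ d : V, Tendsto (fun t : ℝ => z + t • d) (𝓝[>] 0) (𝓝 z) := fun d => by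
    have : Continuous fun t : ℝ => z + t • d := by fun_prop
    simpa using (this.tendsto 0).mono_left nhdsWithin_le_nhds
  have hpos : ∀ d : V, ∀ᶠ t in 𝓝[>] (0 : ℝ), 0 < f d ↔ e < g z + t * g d := fun d => by
    filter_upwards [(hlim d).eventually (hWo.mem_nhds hz), self_mem_nhdsWithin] with t h1 h2
    have h3 := hfg _ h1
    rw [map_add, map_add, map_smul, map_smul, hfz, lt_add_iff_pos_right, smul_eq_mul, smul_eq_mul,
      mul_pos_iff_of_pos_left h2] at h3
    exact h3
  have hgz : g z = e := by
    refine le_antisymm (not_lt.1 fun h => ?_) ?_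
    · exact lt_irrefl c (hfz ▸ (hfg z hz).2 h)
    · have hd : 0 < f (p - z) := by rw [map_sub]; linarith
      have : Tendsto (fun t : ℝ => g (z + t • (p - z))) (𝓝[>] 0) (𝓝 (g z)) :=
        (g.continuous.tendsto z).comp (hlim _)
      refine ge_of_tendsto this ((hpos (p - z)).mono fun t ht => ?_)
      rw [map_add, map_smul, smul_eq_mul]
      exact (ht.1 hd).le
  have hpos' : ∀ d, 0 < f d ↔ 0 < g d := fun d => by
    obtain ⟨t, h1, h2⟩ := ((hpos d).and self_mem_nhdsWithin).exists
    rwa [hgz, lt_add_iff_pos_right, mul_pos_iff_of_pos_left h2] at h1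
  ext v
  have h1 := hpos' (v - z)
  have h2 := hpos' (z - v)
  simp only [map_sub, hfz, hgz, sub_pos] at h1 h2
  simp only [Set.mem_ofPred_eq]
  constructor
  · intro h
    exact le_antisymm (not_lt.1 fun h' => (h1.2 h').ne' h) (not_lt.1 fun h' => (h2.2 h').ne h)
  · intro h
    exact le_antisymm (not_lt.1 fun h' => (h1.1 h').ne' h) (not_lt.1 fun h' => (h2.1 h').ne h)

/-- In a maximal family, hyperplanes separating `U i` from members that are not uniquely separated
from it are not needed to describe `U i`. -/
theorem polyhedron_diff_subset_of_maximal [Finite ι] {D : Set V} (hDo : IsOpen D)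
    (hDc : Convex ℝ D) {U : ι → Set V} (hU : Maximal (IsCellFamily D) U) {i : ι}
    (hne : (U i).Nonempty) (R : Finset ι) :
    (∀ j ∈ R, j ≠ i ∧ ¬ UniquelySeparated (U i) (U j)) → ∀ {f : ι → V →L[ℝ] ℝ} {c : ι → ℝ},
    (∀ j, j ≠ i → Separates (f j) (c j) (U i) (U j)) →
    polyhedron D f c {j | j ≠ i ∧ j ∉ R} ⊆ U i := by
  classical
  induction R using Finset.induction_on with
  | empty =>
    intro _ f c hf
    simpa using polyhedron_subset_of_maximal hDo hDc hU hf
  | insert j R hjR ih =>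
    intro hR f c hf
    have ih := fun {f c} => @ih (fun k hk => hR k (Finset.mem_insert_of_mem hk)) f c
    obtain ⟨hji, hnu⟩ := hR j (Finset.mem_insert_self _ _)
    obtain ⟨g, e, hge, hne'⟩ : ∃ g e, Separates g e (U i) (U j) ∧
        {v | f j v = c j} ≠ {v | g v = e} := by
      simp only [UniquelySeparated, not_forall] at hnu
      obtain ⟨g, e, g', e', h1, h2, h3⟩ := hnu
      by_cases h : {v | f j v = c j} = {v | g v = e}
      · exact ⟨g', e', h2, h ▸ h3⟩
      · exact ⟨g, e, h1, h⟩
    intro q hq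
    set W := polyhedron D f c {k | k ≠ i ∧ k ∉ insert j R} with hW
    have hUW : U i ⊆ W := fun p hp => ⟨hU.prop.subset i hp, fun k hk => (hf k hk.1).1 p hp⟩
    have h1 : ∀ v ∈ W, c j < f j v → v ∈ U i := fun v hv hvj => by
      refine ih hf ⟨hv.1, fun k hk => ?_⟩
      rcases eq_or_ne k j with rfl | hkj
      · exact hvj
      · exact hv.2 k ⟨hk.1, by simp [hkj, hk.2]⟩
    have h2 : ∀ v ∈ W, e < g v → v ∈ U i := fun v hv hvj => by
      refine ih (f := Function.update f j g) (c := Function.update c j e) (fun k hk => ?_)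
        ⟨hv.1, fun k hk => ?_⟩
      · rcases eq_or_ne k j with rfl | hkj
        · simpa using hge
        · simpa [Function.update_of_ne hkj] using hf k hk
      · rcases eq_or_ne k j with rfl | hkj
        · simpa using hvj
        · simpa [Function.update_of_ne hkj] using hv.2 k ⟨hk.1, by simp [hkj, hk.2]⟩
    refine h1 q hq (not_le.1 fun hle => hne' ?_)
    obtain ⟨p, hp⟩ := hne
    exact setOf_apply_eq_of_forall_lt_iff (isOpen_polyhedron hDo f c _)
      (convex_polyhedron hDc f c _)
      (fun v hv => ⟨fun h => hge.1 v (h1 v hv h), fun h => (hf j hji).1 v (h2 v hv h)⟩)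
      (hUW hp) hq ((hf j hji).1 p hp) hle

theorem segment_inter_setOf_apply_eq_nonempty {f : V →L[ℝ] ℝ} {c : ℝ} {p q : V} (hp : c < f p)
    (hq : f q ≤ c) : (segment ℝ p q ∩ {v | f v = c}).Nonempty := by
  have hpos : 0 < f p - f q := by linarith
  refine ⟨q + ((c - f q) / (f p - f q)) • (p - q), ?_, ?_⟩
  · exact (convex_segment p q).add_smul_sub_mem (right_mem_segment ℝ p q) (left_mem_segment ℝ p q)
      ⟨div_nonneg (by linarith) hpos.le, (div_le_one hpos).2 (by linarith)⟩
  · rw [Set.mem_ofPred_eq, map_add, map_smul, map_sub, smul_eq_mul, div_mul_cancel₀ _ hpos.ne']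
    ring

/-- In a maximal family, segments between different members cross a hyperplane that uniquely
separates two members. -/
theorem exists_uniquelySeparated_of_maximal [Finite ι] {D : Set V} (hDo : IsOpen D)
    (hDc : Convex ℝ D) {U : ι → Set V} (hU : Maximal (IsCellFamily D) U) {i j : ι} (hij : i ≠ j)
    {f : ι → V →L[ℝ] ℝ} {c : ι → ℝ} (hf : ∀ k, k ≠ i → Separates (f k) (c k) (U i) (U k))
    {p q : V} (hp : p ∈ U i) (hq : q ∈ U j) :
    ∃ k, k ≠ i ∧ UniquelySeparated (U i) (U k) ∧
      (segment ℝ p q ∩ {v | f k v = c k}).Nonempty := by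
  classical
  have := Fintype.ofFinite ι
  by_contra! hcon
  refine Set.disjoint_left.1 (hU.prop.disjoint hij) ?_ hq
  refine polyhedron_diff_subset_of_maximal hDo hDc hU ⟨p, hp⟩
    (Finset.univ.filter fun k => k ≠ i ∧ ¬ UniquelySeparated (U i) (U k)) (by simp) hf
    ⟨hU.prop.subset j hq, fun k hk => ?_⟩
  have hku : UniquelySeparated (U i) (U k) := by
    by_contra h
    exact hk.2 (by simp [hk.1, h])
  by_contra! hle
  exact (segment_inter_setOf_apply_eq_nonempty ((hf k hk.1).1 p hp) hle).ne_empty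
    (hcon k hk.1 hku)

end Cells

section Lines

variable {ι : Type*}

open Filter Topology in
theorem exists_isCellFamily [Finite ι] {V : Type*} [NormedAddCommGroup V] [NormedSpace ℝ V]
    {C : ι → Set V} (hcomp : ∀ i, IsCompact (C i)) (hconv : ∀ i, Convex ℝ (C i))
    (hdisj : Pairwise fun i j => Disjoint (C i) (C j)) :
    ∃ D U, IsOpen D ∧ Convex ℝ D ∧ Bornology.IsBounded D ∧ IsCellFamily D U ∧ C ≤ U := by
  have hev : ∀ᶠ δ in 𝓝[>] (0 : ℝ), ∀ i j, i ≠ j →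
      Disjoint (Metric.thickening δ (C i)) (Metric.thickening δ (C j)) := by
    simp only [eventually_all]
    intro i j hij
    obtain ⟨δ, hδ, h⟩ := (hdisj hij).exists_thickenings (hcomp i) (hcomp j).isClosed
    filter_upwards [Ioc_mem_nhdsGT hδ] with ε hε
    exact h.mono (Metric.thickening_mono hε.2 _) (Metric.thickening_mono hε.2 _)
  obtain ⟨δ, hδ, hδ0⟩ := (hev.and self_mem_nhdsWithin).exists
  have hb : Bornology.IsBounded (⋃ i, Metric.thickening δ (C i)) :=
    Bornology.isBounded_iUnion.2 fun i => (hcomp i).isBounded.thickening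
  obtain ⟨r, hr⟩ := hb.subset_ball 0
  exact ⟨Metric.ball 0 r, fun i => Metric.thickening δ (C i), Metric.isOpen_ball, convex_ball 0 r,
    Metric.isBounded_ball, ⟨fun i => Metric.isOpen_thickening, fun i => (hconv i).thickening δ,
      fun i => (Set.subset_iUnion _ i).trans hr, fun i j hij => hδ i j hij⟩,
    fun i => Metric.self_subset_thickening hδ0 _⟩

theorem planeCoords_shear (s : ℝ) :
    PlaneCoords (ContinuousLinearMap.fst ℝ ℝ ℝ + s • ContinuousLinearMap.snd ℝ ℝ ℝ)
      (ContinuousLinearMap.snd ℝ ℝ ℝ) (1, 0) (-s, 1) := by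
  constructor
  · intro v
    ext <;> simp
    ring
  all_goals simp

theorem apply_prod_eq (f : ℝ × ℝ →L[ℝ] ℝ) (v : ℝ × ℝ) :
    f v = f (1, 0) * v.1 + f (0, 1) * v.2 := by
  have : v = v.1 • ((1 : ℝ), (0 : ℝ)) + v.2 • ((0 : ℝ), (1 : ℝ)) := by ext <;> simp
  conv_lhs => rw [this]
  rw [map_add, map_smul, map_smul, smul_eq_mul, smul_eq_mul]
  ring

theorem Separates.coeff_ne_zero {f : ℝ × ℝ →L[ℝ] ℝ} {c : ℝ} {A B : Set (ℝ × ℝ)}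
    (h : Separates f c A B) (hA : A.Nonempty) (hB : B.Nonempty) : (f (1, 0), f (0, 1)) ≠ 0 := by
  obtain ⟨p, hp⟩ := hA
  obtain ⟨q, hq⟩ := hB
  have h1 := (h.2 q hq).trans (h.1 p hp)
  intro h0
  rw [Prod.mk_eq_zero] at h0
  rw [apply_prod_eq f q, apply_prod_eq f p, h0.1, h0.2] at h1
  simp at h1

/-- Any two of at most `m` pairwise disjoint compact convex sets in the plane are separated, in the
sense that every segment between them crosses a line, by one family of `3 * m - 6` lines. -/
theorem exists_lines [Fintype ι] {C : ι → Set (ℝ × ℝ)} (hcomp : ∀ i, IsCompact (C i))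
    (hconv : ∀ i, Convex ℝ (C i)) (hne : ∀ i, (C i).Nonempty)
    (hdisj : Pairwise fun i j => Disjoint (C i) (C j)) {m : ℕ} (hm : 3 ≤ m)
    (hι : Fintype.card ι ≤ m) :
    ∃ L : Finset (Set (ℝ × ℝ)), (∀ ℓ ∈ L, IsLine ℓ) ∧ L.card ≤ 3 * m - 6 ∧
      ∀ i j, i ≠ j → ∀ p ∈ C i, ∀ q ∈ C j, (segment ℝ p q ∩ ⋃ ℓ ∈ L, ℓ).Nonempty := by
  classical
  obtain ⟨D, U₀, hDo, hDc, hDb, hU₀, hCU₀⟩ := exists_isCellFamily hcomp hconv hdisj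
  obtain ⟨U, hU₀U, hU⟩ := hU₀.exists_maximal
  have hUn : ∀ i, (U i).Nonempty := fun i => (hne i).mono ((hCU₀ i).trans (hU₀U i))
  have hsep : ∀ i j, ∃ f c, j ≠ i → Separates f c (U i) (U j) := fun i j => by
    by_cases hij : j = i
    · exact ⟨0, 0, fun h => absurd hij h⟩
    · obtain ⟨f, c, h1, h2⟩ := geometric_hahn_banach_open_open (hU.prop.convex j)
        (hU.prop.isOpen j) (hU.prop.convex i) (hU.prop.isOpen i) (hU.prop.disjoint hij)
      exact ⟨f, c, fun _ => ⟨h2, h1⟩⟩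
  choose f c hf using hsep
  obtain ⟨s, hs⟩ := Infinite.exists_notMem_finset
    (Finset.univ.image fun e : ι × ι => f e.1 e.2 (0, 1) / f e.1 e.2 (1, 0))
  have hcoord := planeCoords_shear s
  have hw : ∀ i j, j ≠ i → f i j (-s, 1) ≠ 0 := fun i j hij h0 => by
    have h1 := (hf i j hij).coeff_ne_zero (hUn i) (hUn j)
    rw [apply_prod_eq] at h0
    rw [ne_eq, Prod.mk_eq_zero, not_and] at h1
    by_cases h2 : f i j (1, 0) = 0
    · rw [h2] at h0
      exact h1 h2 (by simpa using h0)
    · refine hs (Finset.mem_image.2 ⟨(i, j), Finset.mem_univ _, ?_⟩)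
      rw [div_eq_iff h2]
      linarith
  generalize ContinuousLinearMap.fst ℝ ℝ ℝ + s • ContinuousLinearMap.snd ℝ ℝ ℝ = τ at hcoord
  generalize ContinuousLinearMap.snd ℝ ℝ ℝ = η at hcoord
  set F := Finset.univ.filter fun e : ι × ι => ∃ t, Consecutive τ η U e.1 e.2 t with hF
  have hFmem : ∀ e, e ∈ F ↔ ∃ t, Consecutive τ η U e.1 e.2 t := by simp [hF]
  refine ⟨F.image fun e => {v | f e.1 e.2 v = c e.1 e.2}, ?_, ?_, ?_⟩
  · simp only [Finset.mem_image]
    rintro _ ⟨e, he, rfl⟩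
    obtain ⟨t, ht⟩ := (hFmem e).1 he
    refine ⟨_, c e.1 e.2, (hf e.1 e.2 ht.1.symm).coeff_ne_zero (hUn _) (hUn _), ?_⟩
    ext v
    simp only [Set.mem_ofPred_eq]
    rw [apply_prod_eq]
  · exact Finset.card_image_le.trans (card_le_of_forall_consecutive hcoord.eq_zero
      hU.prop.convex hU.prop.disjoint hm hι fun e he => (hFmem e).1 he)
  · intro i j hij p hp q hq
    obtain ⟨k, hki, huniq, x, hxs, hx⟩ := exists_uniquelySeparated_of_maximal hDo hDc hU hij
      (hf i) (hU₀U i (hCU₀ i hp)) (hU₀U j (hCU₀ j hq))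
    obtain ⟨a, b, t, hab, hline⟩ := hcoord.realizedBy hU.prop.isOpen hU.prop.convex hUn
      (fun a => hDb.subset (hU.prop.subset a)) hU.prop.disjoint hki.symm huniq (hf i k hki)
      (hw i k hki)
    refine ⟨x, hxs, Set.mem_biUnion (Finset.mem_image_of_mem _ ((hFmem (a, b)).2 ⟨t, hab⟩)) ?_⟩
    rw [hline _ _ (hf a b hab.1.symm)]
    exact hx

end Lines

/-- An island partition of cardinality `m ≥ 3` induces a set of at most `3m − 6` lines
separating the colors: every bichromatic segment crosses some line. -/
theorem stmt_4 {k : ℕ} (hk : 2 ≤ k) (S : Finset (ℝ × ℝ)) (c : ℝ × ℝ → Fin k)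
    (P : Finset (Set (ℝ × ℝ))) (hP : IsIslandPartition (↑S) c P)
    (hm : 3 ≤ P.card) :
    ∃ L : Finset (Set (ℝ × ℝ)),
      (∀ ℓ ∈ L, IsLine ℓ) ∧ L.card ≤ 3 * P.card - 6 ∧
      ∀ p ∈ S, ∀ q ∈ S, c p ≠ c q → (segment ℝ p q ∩ ⋃ ℓ ∈ L, ℓ).Nonempty := by
  classical
  obtain ⟨hIM, hdisj, hunion⟩ := hP
  have hmem : ∀ I : P.filter Set.Nonempty, I.1 ∈ P := fun I => (Finset.mem_filter.1 I.2).1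
  have hcover : ∀ p ∈ S, ∃ I : P.filter Set.Nonempty, p ∈ I.1 := fun p hp => by
    have : p ∈ ⋃ I ∈ P, I := hunion ▸ hp
    simp only [Set.mem_iUnion] at this
    obtain ⟨I, hI, hpI⟩ := this
    exact ⟨⟨I, Finset.mem_filter.2 ⟨hI, p, hpI⟩⟩, hpI⟩
  obtain ⟨L, hL, hcard, hcross⟩ := exists_lines
    (C := fun I : P.filter Set.Nonempty => convexHull ℝ I.1)
    (fun I => (S.finite_toSet.subset (hIM _ (hmem I)).1.1).isCompact_convexHull (𝕜 := ℝ))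
    (fun I => convex_convexHull ℝ _)
    (fun I => (Finset.mem_filter.1 I.2).2.mono (subset_convexHull ℝ _))
    (fun I J hIJ => Set.disjoint_iff_inter_eq_empty.2
      (hdisj _ (hmem I) _ (hmem J) fun h => hIJ (Subtype.ext h)))
    hm ((Fintype.card_coe _).trans_le (Finset.card_filter_le _ _))
  refine ⟨L, hL, hcard, fun p hp q hq hpq => ?_⟩
  obtain ⟨I, hI⟩ := hcover p hp
  obtain ⟨J, hJ⟩ := hcover q hq
  refine hcross I J ?_ p (subset_convexHull ℝ _ hI) q (subset_convexHull ℝ _ hJ)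
  rintro rfl
  exact hpq ((hIM _ (hmem I)).2 p hI q hJ)
end

section
/- Let S be a finite set of points in ℝ² colored by c : ℝ² → Fin k (k ≥ 2), and let L be a finite set of m lines in ℝ² such that no point of S lies on any line of L, and such that any two points of S lying in the same connected component of ℝ² \ ⋃L have the same color. Then S admits an island partition of cardinality at most 1 + m + m(m−1)/2. -/
open scoped Classical in
/-- The indices of the lines `a i · x = b i` on whose positive side `x` lies. -/
noncomputable def positiveSides {ι : Type*} [Fintype ι] (a : ι → ℝ × ℝ) (b : ι → ℝ)
    (x : ℝ × ℝ) : Finset ι :=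
  Finset.univ.filter fun i => b i < (a i).1 * x.1 + (a i).2 * x.2

/-- The open cell of the arrangement of lines `a i · x = b i` with positive sides `u`. -/
def openCell {ι : Type*} (a : ι → ℝ × ℝ) (b : ι → ℝ) (u : Finset ι) : Set (ℝ × ℝ) :=
  {x | ∀ i, (i ∈ u → b i < (a i).1 * x.1 + (a i).2 * x.2) ∧
    (i ∉ u → (a i).1 * x.1 + (a i).2 * x.2 < b i)}

section Arrangement

variable {ι : Type*} {a : ι → ℝ × ℝ} {b : ι → ℝ}

theorem mem_positiveSides [Fintype ι] {x : ℝ × ℝ} {i : ι} :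
    i ∈ positiveSides a b x ↔ b i < (a i).1 * x.1 + (a i).2 * x.2 := by
  simp [positiveSides]

theorem convex_openCell (u : Finset ι) : Convex ℝ (openCell a b u) := by
  intro x hx y hy s t hs ht hst i
  have key : (a i).1 * (s • x + t • y).1 + (a i).2 * (s • x + t • y).2 - b i
      = s * ((a i).1 * x.1 + (a i).2 * x.2 - b i) + t * ((a i).1 * y.1 + (a i).2 * y.2 - b i) := by
    simp only [Prod.fst_add, Prod.snd_add, Prod.smul_fst, Prod.smul_snd, smul_eq_mul]
    linear_combination b i * hst
  have hs' : 0 < s ∨ 0 < t := by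
    by_contra! h
    linarith
  constructor
  · intro hi
    have h1 := (hx i).1 hi
    have h2 := (hy i).1 hi
    rw [← sub_pos, key]
    rcases hs' with h | h
    · exact add_pos_of_pos_of_nonneg (mul_pos h (sub_pos.2 h1)) (mul_nonneg ht (sub_pos.2 h2).le)
    · exact add_pos_of_nonneg_of_pos (mul_nonneg hs (sub_pos.2 h1).le) (mul_pos h (sub_pos.2 h2))
  · intro hi
    have h1 := (hx i).2 hi
    have h2 := (hy i).2 hi
    rw [← sub_neg, key]
    rcases hs' with h | h
    · exact add_neg_of_neg_of_nonpos (mul_neg_of_pos_of_neg h (sub_neg.2 h1))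
        (mul_nonpos_of_nonneg_of_nonpos ht (sub_neg.2 h2).le)
    · exact add_neg_of_nonpos_of_neg (mul_nonpos_of_nonneg_of_nonpos hs (sub_neg.2 h1).le)
        (mul_neg_of_pos_of_neg h (sub_neg.2 h2))

theorem positiveSides_eq_of_mem_openCell [Fintype ι] {u : Finset ι} {x : ℝ × ℝ} (hx : x ∈ openCell a b u) :
    positiveSides a b x = u := by
  ext i
  rw [mem_positiveSides]
  refine ⟨fun h => ?_, (hx i).1⟩
  by_contra hi
  exact h.not_gt ((hx i).2 hi)

theorem mem_openCell_positiveSides [Fintype ι] {x : ℝ × ℝ} (hx : ∀ i, (a i).1 * x.1 + (a i).2 * x.2 ≠ b i) :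
    x ∈ openCell a b (positiveSides a b x) := fun i =>
  ⟨mem_positiveSides.1, fun h => lt_of_le_of_ne (not_lt.1 (mem_positiveSides.not.1 h)) (hx i)⟩

/-- The sign patterns of an arrangement of lines shatter no set of three lines: a linear
dependency among the normals makes one of two opposite sign patterns unattainable. -/
theorem card_le_two_of_shatters [Fintype ι] [DecidableEq ι] {S : Finset (ℝ × ℝ)}
    (hS : ∀ x ∈ S, ∀ i, (a i).1 * x.1 + (a i).2 * x.2 ≠ b i) {s : Finset ι}
    (hs : (S.image (positiveSides a b)).Shatters s) : s.card ≤ 2 := by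
  by_contra! hcard
  have hdep : ¬ LinearIndependent ℝ fun i : s => a i := fun h => by
    have := h.fintype_card_le_finrank
    simp only [Fintype.card_coe, Module.finrank_prod, Module.finrank_self] at this
    omega
  obtain ⟨g, hg, j, hj⟩ := Fintype.not_linearIndependent_iff.1 hdep
  have hsum (x : ℝ × ℝ) : ∑ i : s, g i * ((a i).1 * x.1 + (a i).2 * x.2 - b i)
      = - ∑ i : s, g i * b i := by
    have h1 : ∑ i : s, g i * (a i).1 = 0 := by simpa [Prod.fst_sum] using congrArg Prod.fst hg
    have h2 : ∑ i : s, g i * (a i).2 = 0 := by simpa [Prod.snd_sum] using congrArg Prod.snd hg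
    calc _ = ∑ i : s, (g i * (a i).1 * x.1 + g i * (a i).2 * x.2 - g i * b i) :=
          Finset.sum_congr rfl fun i _ => by ring
      _ = _ := by
          rw [Finset.sum_sub_distrib, Finset.sum_add_distrib, ← Finset.sum_mul, ← Finset.sum_mul,
            h1, h2]
          ring
  have realize (h : s → ℝ) : ∃ x ∈ S, ∀ i : s,
      (0 < h i ↔ 0 < (a i).1 * x.1 + (a i).2 * x.2 - b i) := by
    obtain ⟨u, hu, hst⟩ := hs (t := (Finset.univ.filter fun i : s => 0 < h i).map
      (Function.Embedding.subtype _)) (by intro i; simp +contextual)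
    obtain ⟨x, hx, rfl⟩ := Finset.mem_image.1 hu
    refine ⟨x, hx, fun i => ?_⟩
    have := Finset.ext_iff.1 hst i
    simp only [Finset.mem_inter, i.2, true_and, mem_positiveSides] at this
    rw [sub_pos, this]
    simp
  have positive (h : s → ℝ) (hh : h j ≠ 0) : ∃ x ∈ S,
      0 < ∑ i : s, h i * ((a i).1 * x.1 + (a i).2 * x.2 - b i) := by
    obtain ⟨x, hx, hsign⟩ := realize h
    have hpos (i : s) (hi : h i ≠ 0) : 0 < h i * ((a i).1 * x.1 + (a i).2 * x.2 - b i) := by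
      rcases hi.lt_or_gt with hi | hi
      · exact mul_pos_of_neg_of_neg hi (lt_of_le_of_ne (not_lt.1 ((hsign i).not.1 hi.not_gt))
          (sub_ne_zero.2 (hS x hx i)))
      · exact mul_pos hi ((hsign i).1 hi)
    refine ⟨x, hx, Finset.sum_pos' (fun i _ => ?_) ⟨j, Finset.mem_univ _, hpos j hh⟩⟩
    by_cases hi : h i = 0
    · simp [hi]
    · exact (hpos i hi).le
  obtain ⟨x, -, hx⟩ := positive g hj
  obtain ⟨y, -, hy⟩ := positive (-g) (by simpa using hj)
  simp only [Pi.neg_apply, neg_mul, Finset.sum_neg_distrib] at hy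
  rw [hsum] at hx hy
  linarith

theorem card_image_positiveSides_le [Fintype ι] [DecidableEq ι] {S : Finset (ℝ × ℝ)}
    (hS : ∀ x ∈ S, ∀ i, (a i).1 * x.1 + (a i).2 * x.2 ≠ b i) :
    (S.image (positiveSides a b)).card
      ≤ 1 + Fintype.card ι + Fintype.card ι * (Fintype.card ι - 1) / 2 := by
  have hdim : (S.image (positiveSides a b)).vcDim ≤ 2 :=
    Finset.sup_le fun s hs => card_le_two_of_shatters hS (Finset.mem_shatterer.1 hs)
  calc _ ≤ _ := Finset.card_le_card_shatterer _
    _ ≤ _ := Finset.card_shatterer_le_sum_vcDim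
    _ ≤ ∑ k ∈ Finset.Iic 2, (Fintype.card ι).choose k :=
        Finset.sum_le_sum_of_subset (Finset.Iic_subset_Iic.2 hdim)
    _ = _ := by
        rw [show Finset.Iic 2 = Finset.range 3 from rfl]
        simp [Finset.sum_range_succ, Nat.choose_two_right]

end Arrangement

/-- If a set of `m` lines (avoiding the points of `S`) separates the colors, i.e. any two
points of `S` in the same connected component of the complement of the lines have the same
color, then `S` admits an island partition of cardinality at most `1 + m + m(m−1)/2`. -/
theorem stmt_5 {k : ℕ} (hk : 2 ≤ k) (S : Finset (ℝ × ℝ)) (c : ℝ × ℝ → Fin k)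
    (L : Finset (Set (ℝ × ℝ))) (hL : ∀ ℓ ∈ L, IsLine ℓ)
    (hoff : ∀ p ∈ S, ∀ ℓ ∈ L, p ∉ ℓ)
    (hsep : ∀ p ∈ S, ∀ q ∈ S,
      q ∈ connectedComponentIn (⋃ ℓ ∈ L, ℓ)ᶜ p → c p = c q) :
    ∃ P : Finset (Set (ℝ × ℝ)), IsIslandPartition (↑S) c P ∧
      P.card ≤ 1 + L.card + L.card * (L.card - 1) / 2 := by
  classical
  choose! a b ha hab using hL
  let A : L → ℝ × ℝ := fun ℓ => a ℓ
  let B : L → ℝ := fun ℓ => b ℓ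
  have hmem (ℓ : L) (x : ℝ × ℝ) : x ∈ (ℓ : Set (ℝ × ℝ)) ↔
      (A ℓ).1 * x.1 + (A ℓ).2 * x.2 = B ℓ :=
    iff_of_eq (congrArg (x ∈ ·) (hab ℓ ℓ.2))
  have hS : ∀ x ∈ S, ∀ i, (A i).1 * x.1 + (A i).2 * x.2 ≠ B i := fun x hx i h =>
    hoff x hx i i.2 ((hmem i x).2 h)
  let I : Finset L → Set (ℝ × ℝ) := fun u => {x | x ∈ S ∧ positiveSides A B x = u}
  have hhull (u : Finset L) : convexHull ℝ (I u) ⊆ openCell A B u := by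
    refine convexHull_min ?_ (convex_openCell u)
    rintro x ⟨hx, rfl⟩
    exact mem_openCell_positiveSides (hS x hx)
  have hcell (u : Finset L) : openCell A B u ⊆ (⋃ ℓ ∈ L, ℓ)ᶜ := by
    intro x hx h
    obtain ⟨ℓ, hℓ, hxℓ⟩ := Set.mem_iUnion₂.1 h
    have heq := (hmem ⟨ℓ, hℓ⟩ x).1 hxℓ
    by_cases hu : (⟨ℓ, hℓ⟩ : L) ∈ u
    · exact ((hx _).1 hu).ne' heq
    · exact ((hx _).2 hu).ne heq
  refine ⟨(S.image (positiveSides A B)).image I, ⟨?_, ?_, ?_⟩, ?_⟩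
  · intro J hJ
    obtain ⟨u, -, rfl⟩ := Finset.mem_image.1 hJ
    refine ⟨⟨fun x hx => hx.1, ?_⟩, ?_⟩
    · refine Set.Subset.antisymm ?_ fun x hx => ⟨subset_convexHull ℝ _ hx, hx.1⟩
      exact fun x hx => ⟨hx.2, positiveSides_eq_of_mem_openCell (hhull u hx.1)⟩
    · intro p hp q hq
      have hp' := hhull u (subset_convexHull ℝ _ hp)
      have hq' := hhull u (subset_convexHull ℝ _ hq)
      exact hsep p hp.1 q hq.1
        ((convex_openCell u).isPreconnected.subset_connectedComponentIn hp' (hcell u) hq')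
  · intro J hJ K hK hne
    obtain ⟨u, -, rfl⟩ := Finset.mem_image.1 hJ
    obtain ⟨v, -, rfl⟩ := Finset.mem_image.1 hK
    refine Set.eq_empty_of_forall_notMem fun x hx => hne ?_
    rw [← positiveSides_eq_of_mem_openCell (hhull u hx.1),
      positiveSides_eq_of_mem_openCell (hhull v hx.2)]
  · ext x
    simp only [Set.mem_iUnion, exists_prop, Finset.exists_mem_image, Finset.mem_coe]
    exact ⟨fun ⟨_, _, h⟩ => h.1, fun hx => ⟨x, hx, hx, rfl⟩⟩
  · refine Finset.card_image_le.trans ((card_image_positiveSides_le hS).trans ?_)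
    simp
end

section
/- Let L be a finite set of lines in ℝ². Then every connected component of the complement ℝ² \ ⋃L is a convex set. -/
/-- If a segment with endpoints in a preconnected set meets a line, so does that set. -/
theorem IsPreconnected.exists_mem_of_segment_meets_isLine {s ℓ : Set (ℝ × ℝ)}
    (hs : IsPreconnected s) (hl : IsLine ℓ) {y z w : ℝ × ℝ} (hy : y ∈ s) (hz : z ∈ s)
    (hw : w ∈ segment ℝ y z) (hwl : w ∈ ℓ) : ∃ p ∈ s, p ∈ ℓ := by
  obtain ⟨a, b, -, rfl⟩ := hl
  obtain ⟨c, d, hc, hd, hcd, rfl⟩ := hw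
  have hf : ContinuousOn (fun x : ℝ × ℝ => a.1 * x.1 + a.2 * x.2) s := by fun_prop
  have hb := (hs.image _ hf).ordConnected.convex
    (Set.mem_image_of_mem _ hy) (Set.mem_image_of_mem _ hz) hc hd hcd
  obtain ⟨p, hp, hpb⟩ := hb
  refine ⟨p, hp, hpb.trans (Eq.trans ?_ hwl)⟩
  simp only [Prod.fst_add, Prod.snd_add, Prod.smul_fst, Prod.smul_snd, smul_eq_mul]
  ring

/-- Every connected component of the complement of a finite set of lines is convex. -/
theorem stmt_7 (L : Finset (Set (ℝ × ℝ))) (hL : ∀ ℓ ∈ L, IsLine ℓ) :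
    ∀ x ∈ (⋃ ℓ ∈ L, ℓ)ᶜ,
      Convex ℝ (connectedComponentIn ((⋃ ℓ ∈ L, ℓ)ᶜ) x) := by
  intro x _
  rw [convex_iff_segment_subset]
  intro y hy z hz
  rw [connectedComponentIn_eq hy]
  refine (convex_segment y z).isPreconnected.subset_connectedComponentIn
    (left_mem_segment ℝ y z) fun w hw hwL => ?_
  obtain ⟨ℓ, hl, hwl⟩ := Set.mem_iUnion₂.mp hwL
  obtain ⟨p, hp, hpl⟩ := isPreconnected_connectedComponentIn.exists_mem_of_segment_meets_isLine
    (hL ℓ hl) hy hz hw hwl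
  exact connectedComponentIn_subset _ _ hp (Set.mem_iUnion₂.mpr ⟨ℓ, hl, hpl⟩)
end

section
/- Let L be a finite set of m lines in ℝ². Then the complement ℝ² \ ⋃L has at most 1 + m + m(m−1)/2 connected components. -/
open Finset in
/-- The family of positivity sets of finitely many affine functions on the plane, taken over the
points at which none of them vanishes, has VC dimension at most two. -/
theorem vcDim_le_two_of_affine {ι : Type*} [Fintype ι] [DecidableEq ι]
    (a : ι → ℝ × ℝ) (b : ι → ℝ) (𝒜 : Finset (Finset ι))
    (h𝒜 : ∀ t ∈ 𝒜, ∃ x : ℝ × ℝ,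
      (∀ i, (a i).1 * x.1 + (a i).2 * x.2 ≠ b i) ∧
      ∀ i, i ∈ t ↔ b i < (a i).1 * x.1 + (a i).2 * x.2) :
    𝒜.vcDim ≤ 2 := by
  refine Finset.sup_le fun s hs ↦ ?_
  rw [mem_shatterer] at hs
  by_contra! hcard
  have hdep : ¬ LinearIndependent ℝ (fun i : s ↦ a i) := fun h ↦ by
    have := h.fintype_card_le_finrank
    simp at this
    omega
  obtain ⟨c, hsum, j, hj⟩ := Fintype.not_linearIndependent_iff.1 hdep
  have h1 : ∑ i : s, c i * (a i).1 = 0 := by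
    simpa [Prod.fst_sum] using congrArg Prod.fst hsum
  have h2 : ∑ i : s, c i * (a i).2 = 0 := by
    simpa [Prod.snd_sum] using congrArg Prod.snd hsum
  have hconst (x : ℝ × ℝ) :
      ∑ i : s, c i * ((a i).1 * x.1 + (a i).2 * x.2 - b i) = -∑ i : s, c i * b i := by
    have : ∑ i : s, c i * ((a i).1 * x.1 + (a i).2 * x.2 - b i) =
        (∑ i : s, c i * (a i).1) * x.1 + (∑ i : s, c i * (a i).2) * x.2
          - ∑ i : s, c i * b i := by
      rw [sum_mul, sum_mul, ← sum_add_distrib, ← sum_sub_distrib]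
      exact sum_congr rfl fun i _ ↦ by ring
    rw [this, h1, h2]
    ring
  have key (d : s → ℝ) (hd : d j ≠ 0) : ∃ x : ℝ × ℝ,
      0 < ∑ i : s, d i * ((a i).1 * x.1 + (a i).2 * x.2 - b i) := by
    classical
    obtain ⟨u, hu, hut⟩ := hs (t := (univ.filter fun i : s ↦ 0 < d i).map
      (Function.Embedding.subtype _)) (fun i hi ↦ by
        obtain ⟨k, -, rfl⟩ := mem_map.1 hi
        exact k.2)
    obtain ⟨x, hx, hxu⟩ := h𝒜 u hu
    have hmem (i : s) : b i < (a i).1 * x.1 + (a i).2 * x.2 ↔ 0 < d i := by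
      rw [← hxu]
      have := congrArg ((i : ι) ∈ ·) hut
      simpa using this
    have hpos (i : s) (hi : d i ≠ 0) :
        0 < d i * ((a i).1 * x.1 + (a i).2 * x.2 - b i) := by
      rcases hi.lt_or_gt with hi | hi
      · have h := (hx i).lt_or_gt.resolve_right fun h ↦ hi.asymm ((hmem i).1 h)
        exact mul_pos_of_neg_of_neg hi (by linarith)
      · have h := (hmem i).2 hi
        exact mul_pos hi (by linarith)
    refine ⟨x, sum_pos' (fun i _ ↦ ?_) ⟨j, mem_univ _, hpos j hd⟩⟩
    by_cases hi : d i = 0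
    · simp [hi]
    · exact (hpos i hi).le
  obtain ⟨x, hx⟩ := key c hj
  obtain ⟨y, hy⟩ := key (-c) (by simpa using hj)
  rw [hconst] at hx
  simp only [Pi.neg_apply, neg_mul, sum_neg_distrib] at hy
  rw [hconst] at hy
  linarith

/-- The points lying on the same side of every affine function as a given point form a
preconnected set. -/
theorem isPreconnected_sameSide {ι : Type*} (a : ι → ℝ × ℝ) (b : ι → ℝ) (t : Set ι) :
    IsPreconnected {x : ℝ × ℝ | ∀ i, (i ∈ t → b i < (a i).1 * x.1 + (a i).2 * x.2) ∧
      (i ∉ t → (a i).1 * x.1 + (a i).2 * x.2 < b i)} := by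
  refine Convex.isPreconnected fun x hx y hy p q hp hq hpq i ↦ ?_
  obtain ⟨hx₁, hx₂⟩ := hx i
  obtain ⟨hy₁, hy₂⟩ := hy i
  obtain rfl : q = 1 - p := by linarith
  simp only [Prod.fst_add, Prod.smul_fst, Prod.snd_add, Prod.smul_snd, smul_eq_mul]
  constructor <;> intro hi
  · have hx := hx₁ hi
    have hy := hy₁ hi
    rcases hp.eq_or_lt with rfl | hp
    · linarith
    · nlinarith [mul_pos hp (sub_pos.2 hx), mul_nonneg hq (sub_pos.2 hy).le]
  · have hx := hx₂ hi
    have hy := hy₂ hi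
    rcases hp.eq_or_lt with rfl | hp
    · linarith
    · nlinarith [mul_pos hp (sub_pos.2 hx), mul_nonneg hq (sub_pos.2 hy).le]

/-- The complement of `m` lines in the plane has at most `1 + m + m(m−1)/2` connected
components. -/
theorem stmt_8 (L : Finset (Set (ℝ × ℝ))) (hL : ∀ ℓ ∈ L, IsLine ℓ) :
    {C : Set (ℝ × ℝ) | ∃ x ∈ (⋃ ℓ ∈ L, ℓ)ᶜ,
        C = connectedComponentIn ((⋃ ℓ ∈ L, ℓ)ᶜ) x}.Finite ∧
    {C : Set (ℝ × ℝ) | ∃ x ∈ (⋃ ℓ ∈ L, ℓ)ᶜ,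
        C = connectedComponentIn ((⋃ ℓ ∈ L, ℓ)ᶜ) x}.ncard ≤
      1 + L.card + L.card * (L.card - 1) / 2 := by
  classical
  choose a b _ hab using fun i : L ↦ hL i i.2
  set U : Set (ℝ × ℝ) := (⋃ ℓ ∈ L, ℓ)ᶜ with hU
  have memU (x : ℝ × ℝ) : x ∈ U ↔ ∀ i : L, (a i).1 * x.1 + (a i).2 * x.2 ≠ b i := by
    have (i : L) : x ∈ (i : Set (ℝ × ℝ)) ↔ (a i).1 * x.1 + (a i).2 * x.2 = b i := by
      rw [hab i]
      rfl
    simp only [hU, Set.mem_compl_iff, Set.mem_iUnion, not_exists, ne_eq, ← this, Subtype.forall]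
  let pos (x : ℝ × ℝ) : Finset L := {i | b i < (a i).1 * x.1 + (a i).2 * x.2}
  have mem_pos (x : ℝ × ℝ) (i : L) : i ∈ pos x ↔ b i < (a i).1 * x.1 + (a i).2 * x.2 := by
    simp [pos]
  have component_eq {x y : ℝ × ℝ} (hx : x ∈ U) (hy : y ∈ U) (hxy : pos x = pos y) :
      connectedComponentIn U x = connectedComponentIn U y := by
    have hside {z : ℝ × ℝ} (hz : z ∈ U) (i : L) :
        (i ∈ pos z → b i < (a i).1 * z.1 + (a i).2 * z.2) ∧
          (i ∉ pos z → (a i).1 * z.1 + (a i).2 * z.2 < b i) :=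
      ⟨(mem_pos z i).1, fun hi ↦ ((memU z).1 hz i).lt_of_le (not_lt.1 (mt (mem_pos z i).2 hi))⟩
    refine connectedComponentIn_eq <|
      (isPreconnected_sameSide a b (pos x : Set L)).subset_connectedComponentIn (hside hx)
        (fun z hz ↦ (memU z).2 fun i ↦ ?_) (hxy ▸ hside hy)
    by_cases hi : i ∈ pos x
    · exact ((hz i).1 hi).ne'
    · exact ((hz i).2 hi).ne
  let 𝒜 : Finset (Finset L) := {t | ∃ x ∈ U, pos x = t}
  have hvc : 𝒜.vcDim ≤ 2 := vcDim_le_two_of_affine a b 𝒜 fun t ht ↦ by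
    obtain ⟨x, hx, rfl⟩ := (Finset.mem_filter.1 ht).2
    exact ⟨x, (memU x).1 hx, mem_pos x⟩
  have hcard : 𝒜.card ≤ 1 + L.card + L.card * (L.card - 1) / 2 := calc
    𝒜.card ≤ ∑ k ∈ Finset.Iic 𝒜.vcDim, (Fintype.card L).choose k :=
      𝒜.card_le_card_shatterer.trans Finset.card_shatterer_le_sum_vcDim
    _ ≤ ∑ k ∈ Finset.Iic 2, (Fintype.card L).choose k :=
      Finset.sum_le_sum_of_subset (Finset.Iic_subset_Iic.2 hvc)
    _ = 1 + L.card + L.card * (L.card - 1) / 2 := by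
      rw [show Finset.Iic 2 = Finset.range 3 from rfl]
      simp [Finset.sum_range_succ, Nat.choose_two_right]
  choose! p hpU hp using fun t (ht : t ∈ 𝒜) ↦ (Finset.mem_filter.1 ht).2
  have hsub : {C : Set (ℝ × ℝ) | ∃ x ∈ U, C = connectedComponentIn U x} ⊆
      (fun t ↦ connectedComponentIn U (p t)) '' (𝒜 : Set (Finset L)) := by
    rintro _ ⟨x, hx, rfl⟩
    have ht : pos x ∈ 𝒜 := Finset.mem_filter.2 ⟨Finset.mem_univ _, x, hx, rfl⟩
    exact ⟨pos x, ht, component_eq (hpU _ ht) hx (hp _ ht)⟩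
  have hfin := 𝒜.finite_toSet.image fun t ↦ connectedComponentIn U (p t)
  refine ⟨hfin.subset hsub, (Set.ncard_le_ncard hsub hfin).trans ?_⟩
  refine (Set.ncard_image_le 𝒜.finite_toSet).trans ?_
  rwa [Set.ncard_coe_finset]
end

section
/- For every k ≥ 1, in the grid instance S_k, each column set C_i (1 ≤ i ≤ k) and each row set L_i (1 ≤ i ≤ k) is a monochromatic island of S_k, and these 2k sets together cover S_k, i.e. S_k = (⋃_{i=1}^{k} C_i) ∪ (⋃_{i=1}^{k} L_i). -/
/-- Blue points of the grid instance: `(2i, 2j+1)` for `1 ≤ i ≤ k`, `0 ≤ j ≤ k`. -/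
def gridBlue (k : ℕ) : Set (ℝ × ℝ) :=
  {p | ∃ i j : ℕ, 1 ≤ i ∧ i ≤ k ∧ j ≤ k ∧ p = (2 * (i : ℝ), 2 * (j : ℝ) + 1)}

/-- Red points of the grid instance: `(2j+1, 2i)` for `1 ≤ i ≤ k`, `0 ≤ j ≤ k`. -/
def gridRed (k : ℕ) : Set (ℝ × ℝ) :=
  {p | ∃ i j : ℕ, 1 ≤ i ∧ i ≤ k ∧ j ≤ k ∧ p = (2 * (j : ℝ) + 1, 2 * (i : ℝ))}

/-- The grid instance `S_k`. -/
def gridS (k : ℕ) : Set (ℝ × ℝ) := gridBlue k ∪ gridRed k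

open Classical

/-- The coloring of the grid instance: blue points get color `0`, all others color `1`. -/
noncomputable def gridColor (k : ℕ) (p : ℝ × ℝ) : Fin 2 :=
  if p ∈ gridBlue k then 0 else 1

/-- The `i`-th column set `C_i = {(2i, 2j+1) : 0 ≤ j ≤ k}`. -/
def gridCol (k i : ℕ) : Set (ℝ × ℝ) :=
  {p | ∃ j : ℕ, j ≤ k ∧ p = (2 * (i : ℝ), 2 * (j : ℝ) + 1)}

/-- The `i`-th row set `L_i = {(2j+1, 2i) : 0 ≤ j ≤ k}`. -/
def gridRow (k i : ℕ) : Set (ℝ × ℝ) :=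
  {p | ∃ j : ℕ, j ≤ k ∧ p = (2 * (j : ℝ) + 1, 2 * (i : ℝ))}

/-- An even natural number and an odd one differ as reals. -/
theorem two_mul_cast_ne_two_mul_cast_add_one (a b : ℕ) : 2 * (a : ℝ) ≠ 2 * (b : ℝ) + 1 := by
  intro h
  have h' : 2 * a = 2 * b + 1 := by exact_mod_cast h
  omega

/-- The points of `S` on the fiber of a linear map form an island. -/
theorem isIsland_of_eq_inter_fiber {S I : Set (ℝ × ℝ)} (f : ℝ × ℝ →ₗ[ℝ] ℝ) (a : ℝ)
    (hI : I = {p | f p = a} ∩ S) : IsIsland S I := by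
  have hIS : I ⊆ S := hI ▸ Set.inter_subset_right
  refine ⟨hIS, Set.Subset.antisymm ?_ (Set.subset_inter (subset_convexHull ℝ I) hIS)⟩
  have hfiber : convexHull ℝ I ⊆ {p | f p = a} :=
    convexHull_min (hI ▸ Set.inter_subset_left) (convex_hyperplane f.isLinear a)
  conv_rhs => rw [hI]
  exact Set.inter_subset_inter_left S hfiber

theorem gridCol_subset_gridBlue {k i : ℕ} (h1 : 1 ≤ i) (hi : i ≤ k) :
    gridCol k i ⊆ gridBlue k := by
  rintro p ⟨j, hj, rfl⟩
  exact ⟨i, j, h1, hi, hj, rfl⟩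

theorem gridRow_subset_gridRed {k i : ℕ} (h1 : 1 ≤ i) (hi : i ≤ k) :
    gridRow k i ⊆ gridRed k := by
  rintro p ⟨j, hj, rfl⟩
  exact ⟨i, j, h1, hi, hj, rfl⟩

theorem gridCol_eq_inter {k i : ℕ} (h1 : 1 ≤ i) (hi : i ≤ k) :
    gridCol k i = {p | LinearMap.fst ℝ ℝ ℝ p = 2 * (i : ℝ)} ∩ gridS k := by
  ext p
  constructor
  · intro hp
    refine ⟨?_, Or.inl (gridCol_subset_gridBlue h1 hi hp)⟩
    obtain ⟨j, -, rfl⟩ := hp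
    rfl
  · rintro ⟨hp, ⟨i', j, -, -, hj, rfl⟩ | ⟨i', j, -, -, -, rfl⟩⟩
    · exact ⟨j, hj, Prod.ext hp rfl⟩
    · exact absurd hp.symm (two_mul_cast_ne_two_mul_cast_add_one i j)

theorem gridRow_eq_inter {k i : ℕ} (h1 : 1 ≤ i) (hi : i ≤ k) :
    gridRow k i = {p | LinearMap.snd ℝ ℝ ℝ p = 2 * (i : ℝ)} ∩ gridS k := by
  ext p
  constructor
  · intro hp
    refine ⟨?_, Or.inr (gridRow_subset_gridRed h1 hi hp)⟩
    obtain ⟨j, -, rfl⟩ := hp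
    rfl
  · rintro ⟨hp, ⟨i', j, -, -, -, rfl⟩ | ⟨i', j, -, -, hj, rfl⟩⟩
    · exact absurd hp.symm (two_mul_cast_ne_two_mul_cast_add_one i j)
    · exact ⟨j, hj, Prod.ext rfl hp⟩

theorem gridColor_of_mem_gridBlue {k : ℕ} {p : ℝ × ℝ} (hp : p ∈ gridBlue k) :
    gridColor k p = 0 :=
  if_pos hp

theorem gridColor_of_mem_gridRed {k : ℕ} {p : ℝ × ℝ} (hp : p ∈ gridRed k) :
    gridColor k p = 1 := by
  refine if_neg ?_
  rintro ⟨i, j, -, -, -, h⟩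
  obtain ⟨i', j', -, -, -, rfl⟩ := hp
  exact two_mul_cast_ne_two_mul_cast_add_one i j' (congrArg Prod.fst h).symm

theorem gridBlue_eq_iUnion (k : ℕ) : gridBlue k = ⋃ i ∈ Finset.Icc 1 k, gridCol k i := by
  ext p
  simp only [gridBlue, gridCol, Set.mem_iUnion, Finset.mem_Icc, Set.mem_ofPred_eq, exists_prop]
  constructor
  · rintro ⟨i, j, h1, hi, hj, hp⟩
    exact ⟨i, ⟨h1, hi⟩, j, hj, hp⟩
  · rintro ⟨i, ⟨h1, hi⟩, j, hj, hp⟩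
    exact ⟨i, j, h1, hi, hj, hp⟩

theorem gridRed_eq_iUnion (k : ℕ) : gridRed k = ⋃ i ∈ Finset.Icc 1 k, gridRow k i := by
  ext p
  simp only [gridRed, gridRow, Set.mem_iUnion, Finset.mem_Icc, Set.mem_ofPred_eq, exists_prop]
  constructor
  · rintro ⟨i, j, h1, hi, hj, hp⟩
    exact ⟨i, ⟨h1, hi⟩, j, hj, hp⟩
  · rintro ⟨i, ⟨h1, hi⟩, j, hj, hp⟩
    exact ⟨i, j, h1, hi, hj, hp⟩

/-- Each column set and each row set of the grid instance is a monochromatic island,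
and together they cover `S_k`. -/
theorem stmt_9 (k : ℕ) (hk : 1 ≤ k) :
    (∀ i : ℕ, 1 ≤ i → i ≤ k →
      IsIsland (gridS k) (gridCol k i) ∧ Monochromatic (gridColor k) (gridCol k i)) ∧
    (∀ i : ℕ, 1 ≤ i → i ≤ k →
      IsIsland (gridS k) (gridRow k i) ∧ Monochromatic (gridColor k) (gridRow k i)) ∧
    gridS k = (⋃ i ∈ Finset.Icc 1 k, gridCol k i) ∪ (⋃ i ∈ Finset.Icc 1 k, gridRow k i) := by
  refine ⟨fun i h1 hi => ⟨isIsland_of_eq_inter_fiber _ _ (gridCol_eq_inter h1 hi), ?_⟩,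
    fun i h1 hi => ⟨isIsland_of_eq_inter_fiber _ _ (gridRow_eq_inter h1 hi), ?_⟩, ?_⟩
  · intro p hp q hq
    rw [gridColor_of_mem_gridBlue (gridCol_subset_gridBlue h1 hi hp),
      gridColor_of_mem_gridBlue (gridCol_subset_gridBlue h1 hi hq)]
  · intro p hp q hq
    rw [gridColor_of_mem_gridRed (gridRow_subset_gridRed h1 hi hp),
      gridColor_of_mem_gridRed (gridRow_subset_gridRed h1 hi hq)]
  · rw [gridS, gridBlue_eq_iUnion, gridRed_eq_iUnion]
end

section
/- For every k ≥ 1, the grid instance S_k admits an island partition of cardinality at most 2k + 1. -/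
open Classical

/-- The points of `gridS k` on the vertical line of abscissa `x`. -/
def gridLine (k : ℕ) (x : ℝ) : Set (ℝ × ℝ) := {p | p ∈ gridS k ∧ p.1 = x}

theorem fst_eq_of_mem_convexHull_gridLine {k : ℕ} {x : ℝ} {p : ℝ × ℝ}
    (hp : p ∈ convexHull ℝ (gridLine k x)) : p.1 = x := by
  have hconv : Convex ℝ {q : ℝ × ℝ | q.1 = x} :=
    convex_hyperplane (LinearMap.fst ℝ ℝ ℝ).isLinear x
  exact convexHull_min (fun q hq => hq.2) hconv hp

theorem isIsland_gridLine (k : ℕ) (x : ℝ) : IsIsland (gridS k) (gridLine k x) := by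
  refine ⟨fun p hp => hp.1, Set.Subset.antisymm ?_ ?_⟩
  · rintro p ⟨hp, hpS⟩
    exact ⟨hpS, fst_eq_of_mem_convexHull_gridLine hp⟩
  · exact fun p hp => ⟨subset_convexHull ℝ _ hp, hp.1⟩

/-- Blue points have even abscissa and red points odd abscissa. -/
theorem fst_ne_of_mem_gridBlue_of_mem_gridRed {k : ℕ} {p q : ℝ × ℝ}
    (hp : p ∈ gridBlue k) (hq : q ∈ gridRed k) : p.1 ≠ q.1 := by
  obtain ⟨i, -, -, -, -, rfl⟩ := hp
  obtain ⟨-, j, -, -, -, rfl⟩ := hq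
  intro h
  dsimp only at h
  have h' : 2 * i = 2 * j + 1 := by exact_mod_cast h
  omega

theorem monochromatic_gridLine (k : ℕ) (x : ℝ) :
    Monochromatic (gridColor k) (gridLine k x) := by
  rintro p ⟨hpS, hp⟩ q ⟨hqS, hq⟩
  have hpq : p.1 = q.1 := hp.trans hq.symm
  have hiff : p ∈ gridBlue k ↔ q ∈ gridBlue k :=
    ⟨fun h => hqS.resolve_right fun h' => fst_ne_of_mem_gridBlue_of_mem_gridRed h h' hpq,
      fun h => hpS.resolve_right fun h' => fst_ne_of_mem_gridBlue_of_mem_gridRed h h' hpq.symm⟩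
  simp only [gridColor, hiff]

theorem exists_fst_eq_of_mem_gridS {k : ℕ} {p : ℝ × ℝ} (hp : p ∈ gridS k) :
    ∃ n ∈ Finset.Icc 1 (2 * k + 1), p.1 = (n : ℝ) := by
  rcases hp with ⟨i, -, hi, hik, -, rfl⟩ | ⟨-, j, -, -, hj, rfl⟩
  · exact ⟨2 * i, Finset.mem_Icc.2 ⟨by omega, by omega⟩, by push_cast; rfl⟩
  · exact ⟨2 * j + 1, Finset.mem_Icc.2 ⟨by omega, by omega⟩, by push_cast; rfl⟩

/-- The grid instance `S_k` admits an island partition of cardinality at most `2k + 1`. -/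
theorem stmt_10 (k : ℕ) (hk : 1 ≤ k) :
    ∃ P : Finset (Set (ℝ × ℝ)),
      IsIslandPartition (gridS k) (gridColor k) P ∧ P.card ≤ 2 * k + 1 := by
  refine ⟨(Finset.Icc 1 (2 * k + 1)).image fun n : ℕ => gridLine k n, ⟨?_, ?_, ?_⟩, ?_⟩
  · intro I hI
    obtain ⟨n, -, rfl⟩ := Finset.mem_image.1 hI
    exact ⟨isIsland_gridLine k n, monochromatic_gridLine k n⟩
  · intro I hI J hJ hIJ
    obtain ⟨m, -, rfl⟩ := Finset.mem_image.1 hI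
    obtain ⟨n, -, rfl⟩ := Finset.mem_image.1 hJ
    refine Set.eq_empty_of_forall_notMem fun p hp => hIJ ?_
    have hmn : (m : ℝ) = n :=
      (fst_eq_of_mem_convexHull_gridLine hp.1).symm.trans
        (fst_eq_of_mem_convexHull_gridLine hp.2)
    exact congrArg (gridLine k) hmn
  · refine Set.Subset.antisymm (Set.iUnion₂_subset fun I hI => ?_) fun p hp => ?_
    · obtain ⟨n, -, rfl⟩ := Finset.mem_image.1 hI
      exact fun p hp => hp.1
    · obtain ⟨n, hn, hpn⟩ := exists_fst_eq_of_mem_gridS hp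
      exact Set.mem_iUnion₂.2 ⟨_, Finset.mem_image_of_mem _ hn, hp, hpn⟩
  · exact Finset.card_image_le.trans (by simp)
end

section
/- For every k ≥ 1, every island partition 𝒫 of the grid instance S_k in which each island is a subset of some column set C_i or of some row set L_i (1 ≤ i ≤ k) satisfies |𝒫| ≥ k² + 2k. -/
open Classical

lemma mk_mem_convexHull_of_vertical {I : Set (ℝ × ℝ)} {x u v w : ℝ} (hu : (x, u) ∈ I)
    (hw : (x, w) ∈ I) (huv : u ≤ v) (hvw : v ≤ w) : (x, v) ∈ convexHull ℝ I := by
  refine segment_subset_convexHull hu hw ?_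
  rw [← Prod.image_mk_segment_right, segment_eq_Icc (huv.trans hvw)]
  exact ⟨v, ⟨huv, hvw⟩, rfl⟩

lemma mk_mem_convexHull_of_horizontal {I : Set (ℝ × ℝ)} {y u v w : ℝ} (hu : (u, y) ∈ I)
    (hw : (w, y) ∈ I) (huv : u ≤ v) (hvw : v ≤ w) : (v, y) ∈ convexHull ℝ I := by
  refine segment_subset_convexHull hu hw ?_
  rw [← Prod.image_mk_segment_left, segment_eq_Icc (huv.trans hvw)]
  exact ⟨v, ⟨huv, hvw⟩, rfl⟩

lemma mem_gridCol_iff {k i a b : ℕ} :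
    ((2 * a : ℝ), (2 * b + 1 : ℝ)) ∈ gridCol k i ↔ a = i ∧ b ≤ k := by
  simp only [gridCol, Set.mem_ofPred_eq, Prod.mk.injEq]
  norm_cast
  grind

lemma mem_gridRow_iff {k i a b : ℕ} :
    ((2 * a + 1 : ℝ), (2 * b : ℝ)) ∈ gridRow k i ↔ b = i ∧ a ≤ k := by
  simp only [gridRow, Set.mem_ofPred_eq, Prod.mk.injEq]
  norm_cast
  grind

lemma blue_notMem_gridRow {k i a b : ℕ} : ((2 * a : ℝ), (2 * b + 1 : ℝ)) ∉ gridRow k i := by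
  simp only [gridRow, Set.mem_ofPred_eq, Prod.mk.injEq]
  norm_cast
  grind

lemma red_notMem_gridCol {k i a b : ℕ} : ((2 * a + 1 : ℝ), (2 * b : ℝ)) ∉ gridCol k i := by
  simp only [gridCol, Set.mem_ofPred_eq, Prod.mk.injEq]
  norm_cast
  grind

/-- The island `I` has its lowest or leftmost point at `(2a, 2b+1)` or `(2a+1, 2b)`: it contains
one of these two points, and its hull avoids the crossing `(2a, 2b)` whenever `a, b ≥ 1`. -/
def StartsAt (I : Set (ℝ × ℝ)) (a b : ℕ) : Prop :=
  (((2 * a : ℝ), (2 * b + 1 : ℝ)) ∈ I ∨ ((2 * a + 1 : ℝ), (2 * b : ℝ)) ∈ I) ∧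
    (1 ≤ a → 1 ≤ b → ((2 * a : ℝ), (2 * b : ℝ)) ∉ convexHull ℝ I)

lemma exists_startsAt {k : ℕ} {P : Finset (Set (ℝ × ℝ))}
    (hP : IsIslandPartition (gridS k) (gridColor k) P)
    (hsub : ∀ I ∈ P, ∃ i : ℕ, 1 ≤ i ∧ i ≤ k ∧ (I ⊆ gridCol k i ∨ I ⊆ gridRow k i))
    {a b : ℕ} (ha : a ≤ k) (hb : b ≤ k) (hab : a ≠ 0 ∨ b ≠ 0) :
    ∃ I ∈ P, StartsAt I a b := by
  obtain ⟨-, hdisj, hcover⟩ := hP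
  have cover : ∀ p ∈ gridS k, ∃ I ∈ P, p ∈ I := fun p hp => by
    rw [← hcover] at hp
    simpa using hp
  have blue : 1 ≤ a → ∃ I ∈ P, ((2 * a : ℝ), (2 * b + 1 : ℝ)) ∈ I := fun h =>
    cover _ (Or.inl ⟨a, b, h, ha, hb, rfl⟩)
  have red : 1 ≤ b → ∃ I ∈ P, ((2 * a + 1 : ℝ), (2 * b : ℝ)) ∈ I := fun h =>
    cover _ (Or.inr ⟨b, a, h, hb, ha, rfl⟩)
  rcases Nat.eq_zero_or_pos a with ha0 | ha1
  · obtain ⟨J, hJ, hm⟩ := red (by omega)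
    exact ⟨J, hJ, Or.inr hm, by omega⟩
  obtain ⟨I, hI, hmI⟩ := blue ha1
  rcases Nat.eq_zero_or_pos b with hb0 | hb1
  · exact ⟨I, hI, Or.inl hmI, by omega⟩
  by_cases hcross : ((2 * a : ℝ), (2 * b : ℝ)) ∈ convexHull ℝ I
  · obtain ⟨J, hJ, hmJ⟩ := red hb1
    refine ⟨J, hJ, Or.inr hmJ, fun _ _ hcrossJ => ?_⟩
    have hne : I ≠ J := by
      rintro rfl
      obtain ⟨i, -, -, h | h⟩ := hsub I hI
      · exact red_notMem_gridCol (h hmJ)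
      · exact blue_notMem_gridRow (h hmI)
    have hmem := Set.mem_inter hcross hcrossJ
    rw [hdisj I hI J hJ hne] at hmem
    exact hmem
  · exact ⟨I, hI, Or.inl hmI, fun _ _ => hcross⟩

lemma StartsAt.eq_of_subset_gridCol {I : Set (ℝ × ℝ)} {k i a b a' b' : ℕ} (hi : 1 ≤ i)
    (hI : I ⊆ gridCol k i) (h : StartsAt I a b) (h' : StartsAt I a' b') : a = a' ∧ b = b' := by
  have hm := h.1.resolve_right fun hr => red_notMem_gridCol (hI hr)
  have hm' := h'.1.resolve_right fun hr => red_notMem_gridCol (hI hr)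
  obtain ⟨rfl, -⟩ := mem_gridCol_iff.1 (hI hm)
  obtain ⟨rfl, -⟩ := mem_gridCol_iff.1 (hI hm')
  refine ⟨rfl, ?_⟩
  rcases lt_trichotomy b b' with hlt | heq | hlt
  · refine absurd (mk_mem_convexHull_of_vertical hm hm' ?_ (by linarith)) (h'.2 hi (by omega))
    norm_cast
    omega
  · exact heq
  · refine absurd (mk_mem_convexHull_of_vertical hm' hm ?_ (by linarith)) (h.2 hi (by omega))
    norm_cast
    omega

lemma StartsAt.eq_of_subset_gridRow {I : Set (ℝ × ℝ)} {k i a b a' b' : ℕ} (hi : 1 ≤ i)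
    (hI : I ⊆ gridRow k i) (h : StartsAt I a b) (h' : StartsAt I a' b') : a = a' ∧ b = b' := by
  have hm := h.1.resolve_left fun hl => blue_notMem_gridRow (hI hl)
  have hm' := h'.1.resolve_left fun hl => blue_notMem_gridRow (hI hl)
  obtain ⟨rfl, -⟩ := mem_gridRow_iff.1 (hI hm)
  obtain ⟨rfl, -⟩ := mem_gridRow_iff.1 (hI hm')
  refine ⟨?_, rfl⟩
  rcases lt_trichotomy a a' with hlt | heq | hlt
  · refine absurd (mk_mem_convexHull_of_horizontal hm hm' ?_ (by linarith)) (h'.2 (by omega) hi)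
    norm_cast
    omega
  · exact heq
  · refine absurd (mk_mem_convexHull_of_horizontal hm' hm ?_ (by linarith)) (h.2 (by omega) hi)
    norm_cast
    omega

/-- Every island partition of the grid instance `S_k` in which each island is contained
in some column set or some row set has cardinality at least `k² + 2k`. -/
theorem stmt_11 (k : ℕ) (hk : 1 ≤ k) (P : Finset (Set (ℝ × ℝ)))
    (hP : IsIslandPartition (gridS k) (gridColor k) P)
    (hsub : ∀ I ∈ P, ∃ i : ℕ, 1 ≤ i ∧ i ≤ k ∧ (I ⊆ gridCol k i ∨ I ⊆ gridRow k i)) :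
    k ^ 2 + 2 * k ≤ P.card := by
  set T := (Finset.range (k + 1) ×ˢ Finset.range (k + 1)).erase (0, 0) with hT
  have hcard : T.card = k ^ 2 + 2 * k := by
    rw [hT, Finset.card_erase_of_mem (by simp), Finset.card_product, Finset.card_range]
    exact Nat.sub_eq_of_eq_add (by ring)
  have hex : ∀ t ∈ T, ∃ I ∈ P, StartsAt I t.1 t.2 := by
    rintro ⟨a, b⟩ ht
    simp only [hT, Finset.mem_erase, Finset.mem_product, Finset.mem_range, ne_eq,
      Prod.mk.injEq] at ht
    exact exists_startsAt hP hsub (by omega) (by omega) (by omega)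
  choose! f hfP hf using hex
  rw [← hcard]
  refine Finset.card_le_card_of_injOn f hfP fun s hs t ht hst => ?_
  have hs' := hf s hs
  rw [hst] at hs'
  obtain ⟨i, hi, -, hcol | hrow⟩ := hsub (f t) (hfP t ht)
  · exact Prod.ext_iff.2 (hs'.eq_of_subset_gridCol hi hcol (hf t ht))
  · exact Prod.ext_iff.2 (hs'.eq_of_subset_gridRow hi hrow (hf t ht))
end

section
/- For every k ≥ 1, every monochromatic island of the grid instance S_k has cardinality at most k + 1. -/
open Classical

/-- An island contains every point of `S` that is the midpoint of two of its points. -/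
theorem IsIsland.midpoint_mem {S I : Set (ℝ × ℝ)} (hI : IsIsland S I) {p q : ℝ × ℝ}
    (hp : p ∈ I) (hq : q ∈ I) (hS : midpoint ℝ p q ∈ S) : midpoint ℝ p q ∈ I := by
  rw [← hI.2]
  exact ⟨(convex_convexHull ℝ I).midpoint_mem (subset_convexHull ℝ I hp)
    (subset_convexHull ℝ I hq), hS⟩

/-- Twice the signed area of the lattice triangle `a b c`. -/
def latticeDet (a b c : ℕ × ℕ) : ℤ :=
  ((b.1 : ℤ) - a.1) * ((c.2 : ℤ) - a.2) - ((b.2 : ℤ) - a.2) * ((c.1 : ℤ) - a.1)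

theorem latticeDet_rotate (a b c : ℕ × ℕ) : latticeDet b c a = latticeDet a b c := by
  unfold latticeDet
  ring

theorem latticeDet_eq_two_mul {a b c m : ℕ × ℕ} (h₁ : a.1 + b.1 = 2 * m.1)
    (h₂ : a.2 + b.2 = 2 * m.2) : latticeDet a b c = 2 * latticeDet a m c := by
  have e₁ : (b.1 : ℤ) = 2 * m.1 - a.1 := by omega
  have e₂ : (b.2 : ℤ) = 2 * m.2 - a.2 := by omega
  unfold latticeDet
  rw [e₁, e₂]
  ring

/-- A set of lattice points that is closed under lattice midpoints and has no two points
differing by an odd amount in both coordinates is collinear. -/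
theorem latticeDet_eq_zero {J : Set (ℕ × ℕ)}
    (hmid : ∀ p ∈ J, ∀ q ∈ J, ∀ r : ℕ × ℕ,
      p.1 + q.1 = 2 * r.1 → p.2 + q.2 = 2 * r.2 → r ∈ J)
    (hodd : ∀ p ∈ J, ∀ q ∈ J, Odd (p.1 + q.1) → ¬ Odd (p.2 + q.2))
    {a b c : ℕ × ℕ} (ha : a ∈ J) (hb : b ∈ J) (hc : c ∈ J) : latticeDet a b c = 0 := by
  induction hn : (latticeDet a b c).natAbs using Nat.strong_induction_on
    generalizing a b c with
  | _ n ih =>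
    have halve : ∀ x ∈ J, ∀ y ∈ J, ∀ z ∈ J, latticeDet x y z = latticeDet a b c →
        Even (x.1 + y.1) → Even (x.2 + y.2) → latticeDet a b c = 0 := by
      rintro x hx y hy z hz hdet ⟨s, hs⟩ ⟨t, ht⟩
      have h₁ : x.1 + y.1 = 2 * s := by omega
      have h₂ : x.2 + y.2 = 2 * t := by omega
      have hm : (s, t) ∈ J := hmid x hx y hy (s, t) h₁ h₂
      have h2 := latticeDet_eq_two_mul (c := z) (m := (s, t)) h₁ h₂
      by_contra h0
      have := ih (latticeDet x (s, t) z).natAbs (by omega) hx hm hz rfl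
      omega
    have hab := hodd a ha b hb
    have hbc := hodd b hb c hc
    have hca := hodd c hc a ha
    have h₁ := halve a ha b hb c hc rfl
    have h₂ := halve b hb c hc a ha (latticeDet_rotate a b c)
    have h₃ := halve c hc a ha b hb (latticeDet_rotate c a b).symm
    simp only [Nat.even_iff, Nat.odd_iff] at hab hbc hca h₁ h₂ h₃
    by_contra h0
    simp only [h0, imp_false] at h₁ h₂ h₃
    omega

/-- A collinear set of lattice points in a `k × (k + 1)` box has at most `k + 1` points. -/
theorem ncard_le_of_latticeDet_eq_zero {k : ℕ} {J : Set (ℕ × ℕ)}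
    (hJ : J ⊆ Set.Icc 1 k ×ˢ Set.Iic k)
    (hdet : ∀ a ∈ J, ∀ b ∈ J, ∀ c ∈ J, latticeDet a b c = 0) : J.ncard ≤ k + 1 := by
  by_cases hcol : ∀ a ∈ J, ∀ b ∈ J, a.1 = b.1
  · calc J.ncard ≤ (Set.Iic k).ncard :=
          Set.ncard_le_ncard_of_injOn Prod.snd (fun p hp => (hJ hp).2)
            (fun p hp q hq h => Prod.ext (hcol p hp q hq) h) (Set.finite_Iic k)
      _ = k + 1 := by rw [← Finset.coe_Iic, Set.ncard_coe_finset, Nat.card_Iic]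
  · push Not at hcol
    obtain ⟨a, ha, b, hb, hne⟩ := hcol
    have hinj : Set.InjOn Prod.fst J := by
      intro p hp q hq h
      refine Prod.ext h ?_
      have hp' := hdet a ha b hb p hp
      have hq' := hdet a ha b hb q hq
      unfold latticeDet at hp' hq'
      rw [h] at hp'
      have hz : ((b.1 : ℤ) - a.1) * ((p.2 : ℤ) - q.2) = 0 := by linarith
      rcases mul_eq_zero.mp hz with h' | h' <;> omega
    calc J.ncard ≤ (Set.Icc 1 k).ncard :=
          Set.ncard_le_ncard_of_injOn Prod.fst (fun p hp => (hJ hp).1) hinj (Set.finite_Icc 1 k)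
      _ ≤ k + 1 := by rw [← Finset.coe_Icc, Set.ncard_coe_finset, Nat.card_Icc]; omega

/-- An island inside a `k × (k + 1)` grid parametrized by `f` has at most `k + 1` points, provided
that whenever two grid points differ by an odd amount in both coordinates, their midpoint lies in
`S` but not in the island. -/
theorem IsIsland.ncard_le_of_subset_image {k : ℕ} {S I : Set (ℝ × ℝ)} (hI : IsIsland S I)
    {f : ℕ × ℕ → ℝ × ℝ} (hfS : f '' (Set.Icc 1 k ×ˢ Set.Iic k) ⊆ S)
    (hIf : I ⊆ f '' (Set.Icc 1 k ×ˢ Set.Iic k))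
    (hmid : ∀ p q r : ℕ × ℕ, p.1 + q.1 = 2 * r.1 → p.2 + q.2 = 2 * r.2 →
      midpoint ℝ (f p) (f q) = f r)
    (hodd : ∀ p ∈ Set.Icc 1 k ×ˢ Set.Iic k, ∀ q ∈ Set.Icc 1 k ×ˢ Set.Iic k,
      Odd (p.1 + q.1) → Odd (p.2 + q.2) → midpoint ℝ (f p) (f q) ∈ S \ I) :
    I.ncard ≤ k + 1 := by
  set J : Set (ℕ × ℕ) := (Set.Icc 1 k ×ˢ Set.Iic k) ∩ f ⁻¹' I with hJ
  have hIJ : f '' J = I := by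
    rw [hJ, Set.image_inter_preimage, Set.inter_eq_right]
    exact hIf
  have hfin : J.Finite :=
    ((Set.finite_Icc 1 k).prod (Set.finite_Iic k)).subset Set.inter_subset_left
  rw [← hIJ]
  refine (Set.ncard_image_le hfin).trans
    (ncard_le_of_latticeDet_eq_zero Set.inter_subset_left fun a ha b hb c hc =>
      latticeDet_eq_zero ?_ ?_ ha hb hc)
  · rintro p ⟨hp, hpI⟩ q ⟨hq, hqI⟩ r h₁ h₂
    have hr : r ∈ Set.Icc 1 k ×ˢ Set.Iic k := by
      simp only [Set.mem_prod, Set.mem_Icc, Set.mem_Iic] at hp hq ⊢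
      omega
    have hm := hmid p q r h₁ h₂
    refine ⟨hr, ?_⟩
    rw [Set.mem_preimage, ← hm]
    exact hI.midpoint_mem hpI hqI (hm ▸ hfS (Set.mem_image_of_mem f hr))
  · rintro p ⟨hp, hpI⟩ q ⟨hq, hqI⟩ h₁ h₂
    have h := hodd p hp q hq h₁ h₂
    exact h.2 (hI.midpoint_mem hpI hqI h.1)

theorem gridBlue_eq_image (k : ℕ) :
    gridBlue k = (fun n : ℕ × ℕ => ((2 * n.1, 2 * n.2 + 1) : ℝ × ℝ)) ''
      (Set.Icc 1 k ×ˢ Set.Iic k) := by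
  ext p
  constructor
  · rintro ⟨i, j, h₁, h₂, h₃, rfl⟩
    exact ⟨(i, j), ⟨⟨h₁, h₂⟩, h₃⟩, rfl⟩
  · rintro ⟨⟨i, j⟩, ⟨⟨h₁, h₂⟩, h₃⟩, rfl⟩
    exact ⟨i, j, h₁, h₂, h₃, rfl⟩

theorem gridRed_eq_image (k : ℕ) :
    gridRed k = (fun n : ℕ × ℕ => ((2 * n.2 + 1, 2 * n.1) : ℝ × ℝ)) ''
      (Set.Icc 1 k ×ˢ Set.Iic k) := by
  ext p
  constructor
  · rintro ⟨i, j, h₁, h₂, h₃, rfl⟩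
    exact ⟨(i, j), ⟨⟨h₁, h₂⟩, h₃⟩, rfl⟩
  · rintro ⟨⟨i, j⟩, ⟨⟨h₁, h₂⟩, h₃⟩, rfl⟩
    exact ⟨i, j, h₁, h₂, h₃, rfl⟩

theorem disjoint_gridBlue_gridRed (k : ℕ) : Disjoint (gridBlue k) (gridRed k) := by
  rw [Set.disjoint_left]
  rintro _ ⟨i, j, -, -, -, rfl⟩ ⟨i', j', -, -, -, h⟩
  have h₁ := congrArg Prod.fst h
  simp only at h₁
  norm_cast at h₁
  omega

theorem Monochromatic.subset_gridBlue_or_gridRed {k : ℕ} {I : Set (ℝ × ℝ)}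
    (hI : I ⊆ gridS k) (hmono : Monochromatic (gridColor k) I) :
    I ⊆ gridBlue k ∨ I ⊆ gridRed k := by
  by_cases h : ∃ p ∈ I, p ∈ gridBlue k
  · obtain ⟨p, hp, hpb⟩ := h
    refine Or.inl fun q hq => ?_
    by_contra hqb
    simpa [gridColor, hpb, hqb] using hmono p hp q hq
  · push Not at h
    exact Or.inr fun q hq => (hI hq).resolve_left (h q hq)

theorem midpoint_prod_eq_iff {p q r : ℝ × ℝ} :
    midpoint ℝ p q = r ↔ p.1 + q.1 = 2 * r.1 ∧ p.2 + q.2 = 2 * r.2 := by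
  rw [midpoint_eq_smul_add, Prod.ext_iff]
  simp only [Prod.smul_fst, Prod.smul_snd, Prod.fst_add, Prod.snd_add, smul_eq_mul, invOf_eq_inv]
  constructor <;> rintro ⟨h₁, h₂⟩ <;> constructor <;> linarith

/-- Every monochromatic island of the grid instance `S_k` has cardinality at most `k + 1`. -/
theorem stmt_12 (k : ℕ) (hk : 1 ≤ k) (I : Set (ℝ × ℝ))
    (hI : IsIsland (gridS k) I) (hmono : Monochromatic (gridColor k) I) :
    I.ncard ≤ k + 1 := by
  have hdisj := Set.disjoint_left.mp (disjoint_gridBlue_gridRed k)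
  rcases hmono.subset_gridBlue_or_gridRed hI.1 with hsub | hsub
  · have himg := gridBlue_eq_image k
    refine hI.ncard_le_of_subset_image (himg ▸ Set.subset_union_left) (himg ▸ hsub) ?_ ?_
    · intro p q r h₁ h₂
      have e₁ : (p.1 : ℝ) + q.1 = 2 * r.1 := mod_cast h₁
      have e₂ : (p.2 : ℝ) + q.2 = 2 * r.2 := mod_cast h₂
      exact midpoint_prod_eq_iff.mpr ⟨by linarith, by linarith⟩
    · rintro p ⟨⟨hp₁, hp₂⟩, hp₃⟩ q ⟨⟨hq₁, hq₂⟩, hq₃⟩ ⟨s, hs⟩ ⟨t, ht⟩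
      simp only [Set.mem_Iic] at hp₃ hq₃
      have e₁ : (p.1 : ℝ) + q.1 = 2 * s + 1 := mod_cast hs
      have e₂ : (p.2 : ℝ) + q.2 = 2 * t + 1 := mod_cast ht
      have hred : midpoint ℝ ((2 * p.1, 2 * p.2 + 1) : ℝ × ℝ) (2 * q.1, 2 * q.2 + 1) ∈
          gridRed k := by
        refine ⟨t + 1, s, by omega, by omega, by omega, midpoint_prod_eq_iff.mpr ?_⟩
        push_cast
        exact ⟨by linarith, by linarith⟩
      exact ⟨Or.inr hred, fun h => hdisj (hsub h) hred⟩
  · have himg := gridRed_eq_image k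
    refine hI.ncard_le_of_subset_image (himg ▸ Set.subset_union_right) (himg ▸ hsub) ?_ ?_
    · intro p q r h₁ h₂
      have e₁ : (p.1 : ℝ) + q.1 = 2 * r.1 := mod_cast h₁
      have e₂ : (p.2 : ℝ) + q.2 = 2 * r.2 := mod_cast h₂
      exact midpoint_prod_eq_iff.mpr ⟨by linarith, by linarith⟩
    · rintro p ⟨⟨hp₁, hp₂⟩, hp₃⟩ q ⟨⟨hq₁, hq₂⟩, hq₃⟩ ⟨s, hs⟩ ⟨t, ht⟩
      simp only [Set.mem_Iic] at hp₃ hq₃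
      have e₁ : (p.1 : ℝ) + q.1 = 2 * s + 1 := mod_cast hs
      have e₂ : (p.2 : ℝ) + q.2 = 2 * t + 1 := mod_cast ht
      have hblue : midpoint ℝ ((2 * p.2 + 1, 2 * p.1) : ℝ × ℝ) (2 * q.2 + 1, 2 * q.1) ∈
          gridBlue k := by
        refine ⟨t + 1, s, by omega, by omega, by omega, midpoint_prod_eq_iff.mpr ?_⟩
        push_cast
        exact ⟨by linarith, by linarith⟩
      exact ⟨Or.inl hblue, fun h => hdisj hblue (hsub h)⟩
end

section
/- For every k ≥ 1, the checkerboard instance T_k = {(i, j) ∈ ℝ² : 1 ≤ i ≤ k, 1 ≤ j ≤ k, i, j ∈ ℤ}, with each point (i, j) colored by the parity of i + j, admits an island partition of cardinality at most 2k − 1. -/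
/-- The checkerboard instance `T_k`: integer points `(i, j)` with `1 ≤ i, j ≤ k`. -/
def checker (k : ℕ) : Set (ℝ × ℝ) :=
  {p | ∃ i j : ℕ, 1 ≤ i ∧ i ≤ k ∧ 1 ≤ j ∧ j ≤ k ∧ p = ((i : ℝ), (j : ℝ))}

/-- The checkerboard coloring: a point `(i, j)` is colored by the parity of `i + j`. -/
noncomputable def checkerColor (p : ℝ × ℝ) : Fin 2 :=
  if (⌊p.1⌋ + ⌊p.2⌋) % 2 = 0 then 0 else 1

/-- The antidiagonal `i + j = s` of the checkerboard instance `T_k`. -/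
def checkerDiagonal (k s : ℕ) : Set (ℝ × ℝ) :=
  {p | p ∈ checker k ∧ p.1 + p.2 = s}

theorem add_eq_of_mem_convexHull_checkerDiagonal {k s : ℕ} {p : ℝ × ℝ}
    (hp : p ∈ convexHull ℝ (checkerDiagonal k s)) : p.1 + p.2 = s := by
  have hconv : Convex ℝ {p : ℝ × ℝ | p.1 + p.2 = s} :=
    convex_hyperplane (LinearMap.fst ℝ ℝ ℝ + LinearMap.snd ℝ ℝ ℝ).isLinear (s : ℝ)
  exact convexHull_min (fun q hq => hq.2) hconv hp

theorem isIsland_checkerDiagonal (k s : ℕ) : IsIsland (checker k) (checkerDiagonal k s) := by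
  refine ⟨fun p hp => hp.1, Set.Subset.antisymm ?_ ?_⟩
  · exact fun p hp => ⟨hp.2, add_eq_of_mem_convexHull_checkerDiagonal hp.1⟩
  · exact fun p hp => ⟨subset_convexHull ℝ _ hp, hp.1⟩

theorem checkerColor_of_mem_checkerDiagonal {k s : ℕ} {p : ℝ × ℝ}
    (hp : p ∈ checkerDiagonal k s) :
    checkerColor p = if (s : ℤ) % 2 = 0 then 0 else 1 := by
  obtain ⟨⟨i, j, -, -, -, -, rfl⟩, h⟩ := hp
  dsimp only at h
  norm_cast at h
  subst h
  simp [checkerColor]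

/-- The checkerboard instance `T_k` admits an island partition of cardinality at most
`2k − 1`. -/
theorem stmt_13 (k : ℕ) (hk : 1 ≤ k) :
    ∃ P : Finset (Set (ℝ × ℝ)),
      IsIslandPartition (checker k) checkerColor P ∧ P.card ≤ 2 * k - 1 := by
  classical
  refine ⟨(Finset.Icc 2 (2 * k)).image (checkerDiagonal k), ⟨?_, ?_, ?_⟩, ?_⟩
  · intro I hI
    obtain ⟨s, -, rfl⟩ := Finset.mem_image.1 hI
    refine ⟨isIsland_checkerDiagonal k s, fun p hp q hq => ?_⟩
    rw [checkerColor_of_mem_checkerDiagonal hp, checkerColor_of_mem_checkerDiagonal hq]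
  · intro I hI J hJ hne
    obtain ⟨s, -, rfl⟩ := Finset.mem_image.1 hI
    obtain ⟨t, -, rfl⟩ := Finset.mem_image.1 hJ
    refine Set.eq_empty_of_forall_notMem fun p hp => hne ?_
    have hst : (s : ℝ) = t :=
      (add_eq_of_mem_convexHull_checkerDiagonal hp.1).symm.trans
        (add_eq_of_mem_convexHull_checkerDiagonal hp.2)
    rw [Nat.cast_injective hst]
  · ext p
    simp only [Set.mem_iUnion, Finset.mem_image, exists_prop]
    constructor
    · rintro ⟨_, ⟨s, -, rfl⟩, hp⟩
      exact hp.1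
    · intro hp
      obtain ⟨i, j, hi, hik, hj, hjk, rfl⟩ := id hp
      exact ⟨_, ⟨i + j, Finset.mem_Icc.2 ⟨by omega, by omega⟩, rfl⟩, hp, by push_cast; rfl⟩
  · refine Finset.card_image_le.trans ?_
    rw [Nat.card_Icc]
    omega
end
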